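/- arXiv:2207.08085 — 2 statements merged into one kernel-verified Lean document; each statement's English description precedes it below -/
import Mathlib

section
/- Under conditions (A.1) and (A.3), the spectral radius of L_M on F^k_b(X) is positive if and only if the subshift X_M contains a periodic point of the shift σ. -/
open Filter MeasureTheory Topology
open scoped ENNReal NNReal BigOperators

namespace TMS

variable {S : Type*}

/-- prepend a symbol to a one-sided sequence -/
def cons (a : S) (ω : ℕ → S) : ℕ → S
  | 0 => a
  | n + 1 => ω n

/-- the shift transformation -/
def shift (ω : ℕ → S) : ℕ → S := fun n => ω (n + 1)

/-- the (one-sided) topological Markov shift with transition matrix `A` -/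
def markovShift (A : S → S → Prop) : Set (ℕ → S) := {ω | ∀ n, A (ω n) (ω (n + 1))}

/-- the cylinder set of a word of length `n`, inside `X` -/
def cylW (X : Set (ℕ → S)) (n : ℕ) (w : Fin n → S) : Set (ℕ → S) :=
  {ω | ω ∈ X ∧ ∀ i : Fin n, ω i = w i}

/-- the cylinder set of a single symbol, inside `X` -/
def cyl1 (X : Set (ℕ → S)) (s : S) : Set (ℕ → S) := {ω | ω ∈ X ∧ ω 0 = s}

/-- Birkhoff sum `S_n φ` -/
noncomputable def birkhoff (φ : (ℕ → S) → ℝ) (n : ℕ) (ω : ℕ → S) : ℝ :=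
  ∑ i ∈ Finset.range n, φ (shift^[i] ω)

open Classical in
/-- the metric `d_θ` -/
noncomputable def dtheta (θ : ℝ) (ω υ : ℕ → S) : ℝ :=
  if ω = υ then 0 else θ ^ sInf {n | ω n ≠ υ n}

/-- supremum norm over `X` -/
noncomputable def supNorm (X : Set (ℕ → S)) (f : (ℕ → S) → ℝ) : ℝ :=
  sSup ((fun ω => |f ω|) '' X)

/-- `C` is a bound witnessing `[f]_k ≤ C`, i.e. `var_n f ≤ C θ^n` for all `n ≥ k`. -/
def LipBound (X : Set (ℕ → S)) (θ : ℝ) (k : ℕ) (f : (ℕ → S) → ℝ) (C : ℝ) : Prop :=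
  ∀ n, k ≤ n → ∀ ω, ω ∈ X → ∀ υ, υ ∈ X → (∀ i, i < n → ω i = υ i) →
    |f ω - f υ| ≤ C * θ ^ n

/-- the seminorm `[f]_k` -/
noncomputable def lipSemi (X : Set (ℕ → S)) (θ : ℝ) (k : ℕ) (f : (ℕ → S) → ℝ) : ℝ :=
  sInf {C | 0 ≤ C ∧ LipBound X θ k f C}

/-- the norm `‖f‖_k = ‖f‖_∞ + [f]_k` -/
noncomputable def normK (X : Set (ℕ → S)) (θ : ℝ) (k : ℕ) (f : (ℕ → S) → ℝ) : ℝ :=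
  supNorm X f + lipSemi X θ k f

/-- `φ` is summable: `Σ_{s : [s] ≠ ∅} exp (sup_{[s]} φ) < ∞` -/
def SummableOn (X : Set (ℕ → S)) (φ : (ℕ → S) → ℝ) : Prop :=
  (∀ s : S, BddAbove (φ '' cyl1 X s)) ∧
    Summable (fun s : {s : S // (cyl1 X s).Nonempty} => Real.exp (sSup (φ '' cyl1 X s.1)))

/-- finite irreducibility of a transition matrix -/
def FinitelyIrreducible (A : S → S → Prop) : Prop :=
  ∃ F : Finset (List S), ∀ a b : S, ∃ w ∈ F, List.Chain' A (a :: (w ++ [b]))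

/-- `X` contains a periodic point of the shift -/
def HasPeriodicPoint (X : Set (ℕ → S)) : Prop :=
  ∃ ω, ω ∈ X ∧ ∃ m, 0 < m ∧ shift^[m] ω = ω

/-- the Ruelle transfer operator `L_M` associated to `M` and the potential `φ` -/
noncomputable def transfer (M : S → S → Prop) (φ : (ℕ → S) → ℝ)
    (f : (ℕ → S) → ℝ) : (ℕ → S) → ℝ :=
  fun ω => ∑' a : {a : S // M a (ω 0)}, Real.exp (φ (cons a ω)) * f (cons a ω)

section Top

variable [TopologicalSpace S]

/-- the cone `Λ^k_c` -/
def cone (X : Set (ℕ → S)) (θ : ℝ) (k : ℕ) (c : ℝ) : Set ((ℕ → S) → ℝ) :=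
  {f | ContinuousOn f X ∧ (∀ ω ∈ X, 0 ≤ f ω) ∧
    ∀ ω ∈ X, ∀ υ ∈ X, (∀ i, i < k → ω i = υ i) →
      f ω ≤ Real.exp (c * dtheta θ ω υ) * f υ}

/-- the space `C_b(X)` of bounded continuous functions -/
def Cb (X : Set (ℕ → S)) : Set ((ℕ → S) → ℝ) :=
  {f | ContinuousOn f X ∧ BddAbove ((fun ω => |f ω|) '' X)}

/-- the space `F^k_b(X)` of bounded weak-Lipschitz functions -/
def Fkb (X : Set (ℕ → S)) (θ : ℝ) (k : ℕ) : Set ((ℕ → S) → ℝ) :=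
  {f | f ∈ Cb X ∧ ∃ C, LipBound X θ k f C}

end Top

/-- operator norm of `L` on the space `F` with norm `N` -/
noncomputable def opNorm (N : ((ℕ → S) → ℝ) → ℝ) (F : Set ((ℕ → S) → ℝ))
    (L : ((ℕ → S) → ℝ) → (ℕ → S) → ℝ) : ℝ :=
  sSup {r | ∃ f ∈ F, N f ≤ 1 ∧ r = N (L f)}

/-- spectral radius of `L` on `(F, N)` via the Gelfand formula -/
noncomputable def specRad (N : ((ℕ → S) → ℝ) → ℝ) (F : Set ((ℕ → S) → ℝ))
    (L : ((ℕ → S) → ℝ) → (ℕ → S) → ℝ) : ℝ :=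
  Filter.limsup (fun n : ℕ => (opNorm N F (L^[n])) ^ ((1 : ℝ) / n)) Filter.atTop

/-- the `n`-th partition function `Σ_{w ∈ Sⁿ, [w] ≠ ∅} exp (sup_{[w]} S_n φ)` -/
noncomputable def partition (X : Set (ℕ → S)) (φ : (ℕ → S) → ℝ) (n : ℕ) : ℝ≥0∞ :=
  ∑' w : {w : Fin n → S // (cylW X n w).Nonempty},
    ENNReal.ofReal (Real.exp (sSup (birkhoff φ n '' cylW X n w.1)))

/-- `P` is the topological pressure of `φ` on `X` -/
def IsPressure (X : Set (ℕ → S)) (φ : (ℕ → S) → ℝ) (P : ℝ) : Prop :=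
  Filter.Tendsto (fun n : ℕ => Real.log (partition X φ n).toReal / (n : ℝ))
    Filter.atTop (nhds P)

/-- there is an `M`-path from `a` to `b` (of length at least one) -/
def reaches (M : S → S → Prop) (a b : S) : Prop :=
  ∃ l : List S, List.Chain M a (l ++ [b])

/-- communication relation `a ↔ b` -/
def comm (M : S → S → Prop) (a b : S) : Prop :=
  a = b ∨ (reaches M a b ∧ reaches M b a)

/-- the submatrix of `M` indexed by `T` -/
def restrictM (M : S → S → Prop) (T : Set S) : S → S → Prop :=
  fun a b => M a b ∧ a ∈ T ∧ b ∈ T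

/-- support of a Borel measure -/
def msupport [TopologicalSpace S] [MeasurableSpace S] (ν : Measure (ℕ → S)) :
    Set (ℕ → S) :=
  {ω | ∀ U : Set (ℕ → S), IsOpen U → ω ∈ U → 0 < ν U}

end TMS

namespace TMSProof

open TMS

lemma cons_mem {S : Type*} {A : S → S → Prop} {a : S} {ω : ℕ → S} (h : A a (ω 0))
    (hω : ω ∈ markovShift A) : cons a ω ∈ markovShift A := by
  intro n
  cases n with
  | zero => exact h
  | succ n => exact hω n

lemma shift_iter {S : Type*} (ω : ℕ → S) (n i : ℕ) : (shift^[n] ω) i = ω (i + n) := by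
  induction n generalizing i with
  | zero => rfl
  | succ n ih =>
    rw [Function.iterate_succ_apply']
    show (shift^[n] ω) (i + 1) = _
    rw [ih]; congr 1; omega

lemma succ_exists {S : Type*} {A : S → S → Prop} (hA : FinitelyIrreducible A) (a : S) :
    ∃ b, A a b := by
  obtain ⟨F, hF⟩ := hA
  obtain ⟨w, -, hw⟩ := hF a a
  cases w with
  | nil =>
    refine ⟨a, ?_⟩
    have : List.IsChain A (a :: a :: []) := hw
    simpa using this
  | cons c w =>
    refine ⟨c, ?_⟩
    have : List.IsChain A (a :: c :: (w ++ [a])) := hw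
    rw [List.isChain_cons_cons] at this
    exact this.1

lemma cyl_nonempty {S : Type*} {A : S → S → Prop} (hA : FinitelyIrreducible A) (a : S) :
    (cyl1 (markovShift A) a).Nonempty := by
  choose g hg using succ_exists hA
  refine ⟨fun n => g^[n] a, ?_, rfl⟩
  intro n
  show A (g^[n] a) (g^[n+1] a)
  rw [Function.iterate_succ_apply']
  exact hg _

lemma path_exists {S : Type*} {M : S → S → Prop} {a b : S} (h : Relation.TransGen M a b) :
    ∃ n, 0 < n ∧ ∃ x : ℕ → S, x 0 = a ∧ x n = b ∧ ∀ i < n, M (x i) (x (i+1)) := by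
  induction h with
  | @single b h =>
    refine ⟨1, one_pos, fun i => if i = 0 then a else b, by simp, by simp, ?_⟩
    intro i hi
    have : i = 0 := by omega
    subst this
    simpa using h
  | @tail b c _ hbc ih =>
    obtain ⟨n, hn, x, h0, hxn, hx⟩ := ih
    refine ⟨n+1, by omega, fun i => if i ≤ n then x i else c, by simpa using h0, by simp, ?_⟩
    intro i hi
    by_cases h : i < n
    · have h1 : i ≤ n := h.le
      have h2 : i + 1 ≤ n := h
      simpa only [if_pos h1, if_pos h2] using hx i h
    · have : i = n := by omega
      subst this
      simpa [hxn] using hbc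

lemma periodic_of_cycle {S : Type*} {M : S → S → Prop} {a : S} (h : Relation.TransGen M a a) :
    HasPeriodicPoint (markovShift M) := by
  obtain ⟨n, hn, x, h0, hxn, hx⟩ := path_exists h
  refine ⟨fun i => x (i % n), ?_, n, hn, ?_⟩
  · intro i
    have h1 : i % n < n := Nat.mod_lt _ hn
    have h2 := hx _ h1
    show M (x (i % n)) (x ((i+1) % n))
    by_cases h3 : i % n + 1 = n
    · have : (i + 1) % n = 0 := by
        rw [Nat.add_mod]
        by_cases h4 : n = 1
        · subst h4; simp [Nat.mod_one]
        · rw [Nat.mod_eq_of_lt (show 1 < n by omega), h3, Nat.mod_self]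
      rw [this, h0, ← hxn]
      rwa [h3] at h2
    · have : (i + 1) % n = i % n + 1 := by
        rw [Nat.add_mod, Nat.mod_eq_of_lt (show 1 < n by omega), Nat.mod_eq_of_lt (by omega)]
      rw [this]; exact h2
  · funext i
    rw [shift_iter]
    simp

lemma exp_diff (x y P : ℝ) (hx : Real.exp x ≤ P) (hy : Real.exp y ≤ P) :
    |Real.exp x - Real.exp y| ≤ P * |x - y| := by
  wlog h : y ≤ x generalizing x y
  · rw [abs_sub_comm, abs_sub_comm x]
    exact this y x hy hx (le_of_not_ge h)
  rw [abs_of_nonneg (sub_nonneg.2 (Real.exp_le_exp.2 h)), abs_of_nonneg (sub_nonneg.2 h)]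
  have h1 : Real.exp x - Real.exp y = Real.exp x * (1 - Real.exp (y - x)) := by
    rw [mul_sub, ← Real.exp_add]; simp
  rw [h1]
  have h2 := Real.add_one_le_exp (y - x)
  have h3 : Real.exp x * (1 - Real.exp (y - x)) ≤ Real.exp x * (x - y) :=
    mul_le_mul_of_nonneg_left (by linarith) (Real.exp_pos _).le
  exact h3.trans (mul_le_mul_of_nonneg_right hx (by linarith))

section Main

variable {S : Type*} {A M : S → S → Prop} {φ : (ℕ → S) → ℝ} {p h : S → ℝ} {ρ H : ℝ}

/-- the iterates satisfy the weighted sup bound -/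
lemma sup_bound (hMA : ∀ a b, M a b → A a b) (hp : Summable p) (hp0 : ∀ a, 0 ≤ p a)
    (hφp : ∀ ω ∈ markovShift A, Real.exp (φ ω) ≤ p (ω 0))
    (h1 : ∀ b, 1 ≤ h b) (hH : ∀ b, h b ≤ H)
    (hT : ∀ b, ∑' a : {a : S // M a b}, p a * h a ≤ ρ * h b) (hρ : 0 ≤ ρ)
    {f : (ℕ → S) → ℝ} (hf : ∀ ω ∈ markovShift A, |f ω| ≤ 1) (n : ℕ) :
    ∀ ω ∈ markovShift A, |(transfer M φ)^[n] f ω| ≤ ρ ^ n * h (ω 0) := by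
  have hph : Summable fun a => p a * h a :=
    Summable.of_nonneg_of_le (fun a => mul_nonneg (hp0 a) (by linarith [h1 a]))
      (fun a => mul_le_mul_of_nonneg_left (hH a) (hp0 a)) (hp.mul_right H)
  induction n with
  | zero =>
    intro ω hω
    simpa using (hf ω hω).trans (h1 _)
  | succ n ih =>
    intro ω hω
    rw [Function.iterate_succ_apply']
    have hs : Summable fun a : {a : S // M a (ω 0)} => ρ ^ n * (p a * h a) :=
      (hph.subtype {a | M a (ω 0)}).mul_left _
    have key : |transfer M φ ((transfer M φ)^[n] f) ω| ≤
        ∑' a : {a : S // M a (ω 0)}, ρ ^ n * (p a * h a) := by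
      rw [← Real.norm_eq_abs]
      refine tsum_of_norm_bounded hs.hasSum ?_
      rintro ⟨a, ha⟩
      have hm := cons_mem (hMA _ _ ha) hω
      rw [Real.norm_eq_abs, abs_mul, abs_of_pos (Real.exp_pos _)]
      calc _ ≤ p a * (ρ ^ n * h a) :=
            mul_le_mul (hφp _ hm) (ih _ hm) (abs_nonneg _) (hp0 a)
        _ = _ := by ring
    refine key.trans ?_
    rw [tsum_mul_left, pow_succ, mul_assoc]
    exact mul_le_mul_of_nonneg_left (hT _) (pow_nonneg hρ n)

lemma term_summable (hMA : ∀ a b, M a b → A a b) (hp : Summable p) (hp0 : ∀ a, 0 ≤ p a)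
    (hφp : ∀ ω ∈ markovShift A, Real.exp (φ ω) ≤ p (ω 0))
    {g : (ℕ → S) → ℝ} {B : ℝ} (hg : ∀ ω ∈ markovShift A, |g ω| ≤ B)
    {ω : ℕ → S} (hω : ω ∈ markovShift A) :
    Summable fun a : {a : S // M a (ω 0)} => Real.exp (φ (cons a ω)) * g (cons a ω) := by
  have hs : Summable fun a : {a : S // M a (ω 0)} => p a * B :=
    (hp.subtype {a | M a (ω 0)}).mul_right _
  refine Summable.of_norm_bounded hs ?_
  rintro ⟨a, ha⟩
  have hm := cons_mem (hMA _ _ ha) hω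
  rw [Real.norm_eq_abs, abs_mul, abs_of_pos (Real.exp_pos _)]
  exact mul_le_mul (hφp _ hm) (hg _ hm) (abs_nonneg _) (hp0 a)

lemma lip_bound (hMA : ∀ a b, M a b → A a b) (hp : Summable p) (hp0 : ∀ a, 0 ≤ p a)
    (hφp : ∀ ω ∈ markovShift A, Real.exp (φ ω) ≤ p (ω 0))
    (h1 : ∀ b, 1 ≤ h b) (hH : ∀ b, h b ≤ H)
    (hT : ∀ b, ∑' a : {a : S // M a b}, p a * h a ≤ ρ * h b) (hρ : 0 ≤ ρ)
    {θ : ℝ} (hθ0 : 0 < θ) {k : ℕ} (hk : 1 ≤ k) {C K : ℝ}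
    (hC : LipBound (markovShift A) θ (k + 1) φ C) (hK : 2 ≤ K) (hCK : θ * (C + K) ≤ K)
    {f : (ℕ → S) → ℝ} (hf : ∀ ω ∈ markovShift A, |f ω| ≤ 1)
    (hfl : LipBound (markovShift A) θ k f 2) (n : ℕ) :
    ∀ m, k ≤ m → ∀ ω, ω ∈ markovShift A → ∀ υ, υ ∈ markovShift A → (∀ i, i < m → ω i = υ i) →
    |(transfer M φ)^[n] f ω - (transfer M φ)^[n] f υ| ≤ K * ρ ^ n * h (ω 0) * θ ^ m := by
  have hph : Summable fun a => p a * h a :=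
    Summable.of_nonneg_of_le (fun a => mul_nonneg (hp0 a) (by linarith [h1 a]))
      (fun a => mul_le_mul_of_nonneg_left (hH a) (hp0 a)) (hp.mul_right H)
  have hsup := sup_bound hMA hp hp0 hφp h1 hH hT hρ hf
  induction n with
  | zero =>
    intro m hm ω hω υ hυ hag
    simp only [Function.iterate_zero, id, pow_zero, mul_one]
    refine (hfl m hm ω hω υ hυ hag).trans ?_
    refine mul_le_mul_of_nonneg_right ?_ (pow_pos hθ0 m).le
    nlinarith [h1 (ω 0)]
  | succ n ih =>
    intro m hm ω hω υ hυ hag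
    rw [Function.iterate_succ_apply']
    set g := (transfer M φ)^[n] f with hg
    have h0 : υ 0 = ω 0 := (hag 0 (by omega)).symm
    have hgb : ∀ ω ∈ markovShift A, |g ω| ≤ ρ ^ n * H := fun ω hω =>
      (hsup n ω hω).trans (mul_le_mul_of_nonneg_left (hH _) (pow_nonneg hρ n))
    have e2 : transfer M φ g υ =
        ∑' a : {a : S // M a (ω 0)}, Real.exp (φ (cons a υ)) * g (cons a υ) := by
      unfold transfer; rw [h0]
    have s1 := term_summable hMA hp hp0 hφp hgb hω
    have s2 : Summable fun a : {a : S // M a (ω 0)} =>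
        Real.exp (φ (cons a υ)) * g (cons a υ) := by
      have := term_summable hMA hp hp0 hφp hgb hυ
      rwa [h0] at this
    rw [e2]
    unfold transfer
    rw [← s1.tsum_sub s2]
    have hs : Summable fun a : {a : S // M a (ω 0)} =>
        (K * ρ ^ n * θ ^ m) * (p a * h a) :=
      (hph.subtype {a | M a (ω 0)}).mul_left _
    have key : |∑' a : {a : S // M a (ω 0)}, (Real.exp (φ (cons a ω)) * g (cons a ω)
        - Real.exp (φ (cons a υ)) * g (cons a υ))| ≤
        ∑' a : {a : S // M a (ω 0)}, (K * ρ ^ n * θ ^ m) * (p a * h a) := by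
      rw [← Real.norm_eq_abs]
      refine tsum_of_norm_bounded hs.hasSum ?_
      rintro ⟨a, ha⟩
      have hm1 := cons_mem (hMA _ _ ha) hω
      have hm2 := cons_mem (a := a) (hMA _ _ (h0.symm ▸ ha)) hυ
      have hag' : ∀ i, i < m + 1 → cons a ω i = cons a υ i := by
        intro i hi
        cases i with
        | zero => rfl
        | succ i => exact hag i (by omega)
      have b1 := hC (m+1) (by omega) _ hm1 _ hm2 hag'
      have b2 := ih (m+1) (by omega) _ hm1 _ hm2 hag'
      have b3 := exp_diff _ _ (p a) (hφp _ hm1) (hφp _ hm2)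
      have b4 := hsup n _ hm1
      have b5 := hφp _ hm2
      change _ ≤ K * ρ ^ n * h a * θ ^ (m+1) at b2
      change _ ≤ ρ ^ n * h a at b4
      change _ ≤ p a at b5
      have b6 : |Real.exp (φ (cons a ω)) - Real.exp (φ (cons a υ))| ≤ p a * (C * θ ^ (m+1)) :=
        b3.trans (mul_le_mul_of_nonneg_left b1 (hp0 a))
      rw [Real.norm_eq_abs]
      have b7 : Real.exp (φ (cons a ω)) * g (cons a ω) - Real.exp (φ (cons a υ)) * g (cons a υ)
          = (Real.exp (φ (cons a ω)) - Real.exp (φ (cons a υ))) * g (cons a ω)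
            + Real.exp (φ (cons a υ)) * (g (cons a ω) - g (cons a υ)) := by ring
      show |Real.exp (φ (cons a ω)) * g (cons a ω) - Real.exp (φ (cons a υ)) * g (cons a υ)| ≤ _
      rw [b7]
      refine (abs_add_le _ _).trans ?_
      rw [abs_mul, abs_mul, abs_of_pos (Real.exp_pos _)]
      have c1 := mul_le_mul b6 b4 (abs_nonneg _) ((abs_nonneg _).trans b6)
      have c2 := mul_le_mul b5 b2 (abs_nonneg _) (hp0 a)
      refine (add_le_add c1 c2).trans ?_
      have c3 : 0 ≤ p a * ρ ^ n * h a * θ ^ m :=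
        mul_nonneg (mul_nonneg (mul_nonneg (hp0 a) (pow_nonneg hρ n)) (by linarith [h1 a]))
          (pow_pos hθ0 m).le
      calc _ = (θ * (C + K)) * (p a * ρ ^ n * h a * θ ^ m) := by ring
        _ ≤ K * (p a * ρ ^ n * h a * θ ^ m) := mul_le_mul_of_nonneg_right hCK c3
        _ = _ := by ring
    refine key.trans ?_
    rw [tsum_mul_left]
    have c0 : 0 ≤ K * ρ ^ n * θ ^ m :=
      mul_nonneg (mul_nonneg (by linarith) (pow_nonneg hρ n)) (pow_pos hθ0 m).le
    refine (mul_le_mul_of_nonneg_left (hT _) c0).trans (le_of_eq ?_)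
    ring

lemma supNorm_nonneg (X : Set (ℕ → S)) (f) : 0 ≤ supNorm X f := by
  apply Real.sSup_nonneg
  rintro _ ⟨ω, _, rfl⟩
  exact abs_nonneg _

lemma lipSemi_nonneg (X : Set (ℕ → S)) (θ k f) : 0 ≤ lipSemi X θ k f :=
  Real.sInf_nonneg fun _ h => h.1

lemma opNorm_nonneg (X : Set (ℕ → S)) (θ k F L) : 0 ≤ opNorm (normK X θ k) F L := by
  apply Real.sSup_nonneg
  rintro _ ⟨f, _, _, rfl⟩
  exact add_nonneg (supNorm_nonneg _ _) (lipSemi_nonneg _ _ _ _)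

lemma norm_bound [TopologicalSpace S] (hMA : ∀ a b, M a b → A a b) (hp : Summable p)
    (hp0 : ∀ a, 0 ≤ p a)
    (hφp : ∀ ω ∈ markovShift A, Real.exp (φ ω) ≤ p (ω 0))
    (h1 : ∀ b, 1 ≤ h b) (hH : ∀ b, h b ≤ H) (hH0 : 0 ≤ H)
    (hT : ∀ b, ∑' a : {a : S // M a b}, p a * h a ≤ ρ * h b) (hρ : 0 ≤ ρ)
    {θ : ℝ} (hθ0 : 0 < θ) {k : ℕ} (hk : 1 ≤ k) {C K : ℝ}
    (hC : LipBound (markovShift A) θ (k + 1) φ C) (hK : 2 ≤ K) (hCK : θ * (C + K) ≤ K)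
    {f : (ℕ → S) → ℝ} (hf : f ∈ Fkb (markovShift A) θ k)
    (hf1 : normK (markovShift A) θ k f ≤ 1) (n : ℕ) :
    normK (markovShift A) θ k ((transfer M φ)^[n] f) ≤ (1 + K) * H * ρ ^ n := by
  have a1 := supNorm_nonneg (markovShift A) f
  have a2 := lipSemi_nonneg (markovShift A) θ k f
  unfold normK at hf1
  have b1 : ∀ ω ∈ markovShift A, |f ω| ≤ 1 := by
    intro ω hω
    have : |f ω| ≤ supNorm (markovShift A) f := le_csSup hf.1.2 ⟨ω, hω, rfl⟩
    linarith
  have b2 : LipBound (markovShift A) θ k f 2 := by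
    obtain ⟨C', hC'⟩ := hf.2
    have hne : {C | 0 ≤ C ∧ LipBound (markovShift A) θ k f C}.Nonempty :=
      ⟨max C' 0, le_max_right _ _, fun n hn ω hω υ hυ hag => (hC' n hn ω hω υ hυ hag).trans
        (mul_le_mul_of_nonneg_right (le_max_left _ _) (pow_pos hθ0 n).le)⟩
    have hlt : sInf {C | 0 ≤ C ∧ LipBound (markovShift A) θ k f C} < 2 := by
      change lipSemi (markovShift A) θ k f < 2
      linarith
    obtain ⟨C'', ⟨_, h2⟩, h3⟩ := exists_lt_of_csInf_lt hne hlt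
    exact fun n hn ω hω υ hυ hag => (h2 n hn ω hω υ hυ hag).trans
        (mul_le_mul_of_nonneg_right h3.le (pow_pos hθ0 n).le)
  have c1 : supNorm (markovShift A) ((transfer M φ)^[n] f) ≤ ρ ^ n * H := by
    apply Real.sSup_le
    · rintro _ ⟨ω, hω, rfl⟩
      exact (sup_bound hMA hp hp0 hφp h1 hH hT hρ b1 n ω hω).trans
        (mul_le_mul_of_nonneg_left (hH _) (pow_nonneg hρ n))
    · exact mul_nonneg (pow_nonneg hρ n) hH0
  have c2 : lipSemi (markovShift A) θ k ((transfer M φ)^[n] f) ≤ K * ρ ^ n * H := by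
    apply csInf_le ⟨0, fun _ h => h.1⟩
    refine ⟨mul_nonneg (mul_nonneg (by linarith) (pow_nonneg hρ n)) hH0, ?_⟩
    intro m hm ω hω υ hυ hag
    refine (lip_bound hMA hp hp0 hφp h1 hH hT hρ hθ0 hk hC hK hCK b1 b2 n m hm
      ω hω υ hυ hag).trans ?_
    refine mul_le_mul_of_nonneg_right ?_ (pow_pos hθ0 m).le
    exact mul_le_mul_of_nonneg_left (hH _) (mul_nonneg (by linarith) (pow_nonneg hρ n))
  unfold normK
  calc _ ≤ _ := add_le_add c1 c2
    _ = _ := by ring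

lemma root_tendsto (D : ℝ) (hD : 0 < D) :
    Tendsto (fun n : ℕ => D ^ ((1 : ℝ) / n)) atTop (𝓝 1) := by
  have h := (tendsto_const_div_atTop_nhds_zero_nat (1 : ℝ))
  have h2 := (Real.continuousAt_const_rpow (a := D) (b := 0) hD.ne').tendsto.comp h
  simpa [Function.comp_def] using h2

/-- Lyapunov weight in the acyclic case -/
lemma lyapunov (hp : Summable p) (hp0 : ∀ a, 0 ≤ p a)
    (hac : ∀ a, ¬ Relation.TransGen M a a) {ε : ℝ} (hε : 0 < ε) :
    ∃ (h : S → ℝ) (H : ℝ), 0 ≤ H ∧ (∀ b, 1 ≤ h b) ∧ (∀ b, h b ≤ H) ∧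
      ∀ b, ∑' a : {a : S // M a b}, p a * h a ≤ (2 * ε) * h b := by
  classical
  obtain ⟨E, hE⟩ := ((tendsto_order.1 (tendsto_tsum_compl_atTop_zero p)).2 ε hε).exists
  set Q := ∑ a ∈ E, p a with hQ
  have hQ0 : 0 ≤ Q := Finset.sum_nonneg fun a _ => hp0 a
  set Λ : ℝ := 1 + Q / ε with hΛ
  have hΛ1 : 1 ≤ Λ := by
    have : 0 ≤ Q / ε := div_nonneg hQ0 hε.le
    linarith
  have hΛ0 : 0 < Λ := by linarith
  set r : S → ℕ := fun b => (E.filter fun a => Relation.TransGen M a b).card with hr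
  have hrE : ∀ b, r b ≤ E.card := fun b => Finset.card_filter_le _ _
  have r1 : ∀ a b, M a b → r a ≤ r b := by
    intro a b hab
    apply Finset.card_le_card
    intro c hc
    simp only [Finset.mem_filter] at hc ⊢
    exact ⟨hc.1, hc.2.tail hab⟩
  have r2 : ∀ a b, M a b → a ∈ E → r a + 1 ≤ r b := by
    intro a b hab haE
    apply Finset.card_lt_card
    refine Finset.ssubset_iff_of_subset ?_ |>.2 ⟨a, ?_, ?_⟩
    · intro c hc
      simp only [Finset.mem_filter] at hc ⊢
      exact ⟨hc.1, hc.2.tail hab⟩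
    · simp [haE, Relation.TransGen.single hab]
    · simp [hac a]
  set q : S → ℝ := fun a => p a * (if a ∈ E then Λ⁻¹ else 1) with hq
  have hΛi : Λ⁻¹ ≤ 1 := inv_le_one_of_one_le₀ hΛ1
  have hq0 : ∀ a, 0 ≤ q a := fun a => mul_nonneg (hp0 a) (by split_ifs <;> positivity)
  have hqs : Summable q := by
    refine Summable.of_nonneg_of_le hq0 (fun a => ?_) hp
    exact mul_le_of_le_one_right (hp0 a) (by split_ifs <;> simp [hΛi])
  have hqsum : ∑' a, q a ≤ 2 * ε := by
    rw [← hqs.sum_add_tsum_compl (s := E)]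
    have e1 : ∑ a ∈ E, q a = Q * Λ⁻¹ := by
      rw [hQ, Finset.sum_mul]
      exact Finset.sum_congr rfl fun a ha => by simp [hq, ha]
    have e2 : ∑' a : ↑((E : Set S)ᶜ), q a = ∑' a : {a // a ∉ E}, p a := by
      apply tsum_congr
      rintro ⟨a, ha⟩
      have : a ∉ E := by simpa using ha
      simp [hq, this]
    rw [e1, e2]
    have e3 : Q * Λ⁻¹ ≤ ε := by
      rw [← div_eq_mul_inv, div_le_iff₀ hΛ0, hΛ]
      field_simp
      linarith
    linarith
  refine ⟨fun b => Λ ^ r b, Λ ^ E.card, by positivity, fun b => one_le_pow₀ hΛ1,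
    fun b => pow_le_pow_right₀ hΛ1 (hrE b), ?_⟩
  intro b
  have s2 : Summable fun a : {a : S // M a b} => q a * Λ ^ r b :=
    (hqs.subtype {a | M a b}).mul_right _
  have tb : ∀ a : {a : S // M a b}, p a * Λ ^ r a.1 ≤ q a * Λ ^ r b := by
    rintro ⟨a, ha⟩
    simp only [hq]
    rw [mul_assoc]
    refine mul_le_mul_of_nonneg_left ?_ (hp0 a)
    split_ifs with haE
    · rw [inv_mul_eq_div, le_div_iff₀ hΛ0, ← pow_succ]
      exact pow_le_pow_right₀ hΛ1 (r2 a b ha haE)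
    · rw [one_mul]; exact pow_le_pow_right₀ hΛ1 (r1 a b ha)
  have s1 : Summable fun a : {a : S // M a b} => p a * Λ ^ r a.1 :=
    Summable.of_nonneg_of_le (fun a => mul_nonneg (hp0 a) (by positivity)) tb s2
  refine (s1.tsum_le_tsum tb s2).trans ?_
  rw [tsum_mul_right]
  refine mul_le_mul_of_nonneg_right ?_ (by positivity)
  exact (hqs.tsum_subtype_le q {a | M a b} hq0).trans hqsum

lemma lower (hMA : ∀ a b, M a b → A a b) (hp : Summable p) (hp0 : ∀ a, 0 ≤ p a)
    (hφp : ∀ ω ∈ markovShift A, Real.exp (φ ω) ≤ p (ω 0))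
    (hb : ∀ n, ∃ B, ∀ ω ∈ markovShift A, |(transfer M φ)^[n] (fun _ => 1) ω| ≤ B)
    {ω : ℕ → S} (hω : ω ∈ markovShift M) {β : ℝ} (hβ : ∀ n, β ≤ φ (shift^[n] ω)) (n : ℕ) :
    Real.exp β ^ n ≤ (transfer M φ)^[n] (fun _ => 1) (shift^[n] ω) := by
  have hmem : ∀ n, shift^[n] ω ∈ markovShift A := by
    intro n i
    rw [shift_iter, shift_iter, Nat.add_right_comm]
    exact hMA _ _ (hω _)
  have hpos : ∀ n, ∀ υ, 0 ≤ (transfer M φ)^[n] (fun _ => (1:ℝ)) υ := by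
    intro n
    induction n with
    | zero => intro υ; simp
    | succ n ih =>
      intro υ
      rw [Function.iterate_succ_apply']
      exact tsum_nonneg fun a => mul_nonneg (Real.exp_pos _).le (ih _)
  induction n with
  | zero => simp
  | succ n ih =>
    rw [Function.iterate_succ_apply' (transfer M φ)]
    obtain ⟨B, hB⟩ := hb n
    have hs := term_summable hMA hp hp0 hφp hB (hmem (n+1))
    have hMM : M (ω n) ((shift^[n+1] ω) 0) := by
      rw [shift_iter, Nat.zero_add]; exact hω n
    have hle := hs.le_tsum ⟨ω n, hMM⟩
      (fun a _ => mul_nonneg (Real.exp_pos _).le (hpos n _))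
    refine le_trans ?_ hle
    have hc : cons (ω n) (shift^[n+1] ω) = shift^[n] ω := by
      funext i
      cases i with
      | zero => rw [shift_iter, Nat.zero_add]; rfl
      | succ i =>
        show (shift^[n+1] ω) i = _
        rw [shift_iter, shift_iter]; congr 1; omega
    show _ ≤ Real.exp (φ (cons (ω n) (shift^[n+1] ω))) * _
    rw [hc, pow_succ, mul_comm]
    exact mul_le_mul (Real.exp_le_exp.2 (hβ n)) ih (by positivity) (Real.exp_pos _).le

end Main

end TMSProof

/-- under (A.1) and (A.3), the spectral radius of `L_M` on `F^k_b(X)`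
is positive iff `X_M` has a periodic point. -/
theorem stmt5 {S : Type*} [Countable S] [TopologicalSpace S] [DiscreteTopology S]
    (A M : S → S → Prop) (hMA : ∀ a b, M a b → A a b)
    (hA : TMS.FinitelyIrreducible A)
    (θ : ℝ) (hθ0 : 0 < θ) (hθ1 : θ < 1) (k : ℕ) (hk : 1 ≤ k)
    (φ : (ℕ → S) → ℝ) (hφ : TMS.SummableOn (TMS.markovShift A) φ)
    (hφlip : ∃ C, TMS.LipBound (TMS.markovShift A) θ (k + 1) φ C) :
    0 < TMS.specRad (TMS.normK (TMS.markovShift A) θ k)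
        (TMS.Fkb (TMS.markovShift A) θ k) (TMS.transfer M φ) ↔
      TMS.HasPeriodicPoint (TMS.markovShift M) := by
  classical
  set p : S → ℝ := fun s => Real.exp (sSup (φ '' TMS.cyl1 (TMS.markovShift A) s)) with hpdef
  have hp : Summable p :=
    (Equiv.subtypeUnivEquiv (TMSProof.cyl_nonempty hA)).summable_iff.1 hφ.2
  have hp0 : ∀ a, 0 ≤ p a := fun a => (Real.exp_pos _).le
  have hφp : ∀ ω ∈ TMS.markovShift A, Real.exp (φ ω) ≤ p (ω 0) := fun ω hω =>
    Real.exp_le_exp.2 (le_csSup (hφ.1 (ω 0)) ⟨ω, ⟨hω, rfl⟩, rfl⟩)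
  obtain ⟨C, hC0, hC⟩ : ∃ C, 0 ≤ C ∧ TMS.LipBound (TMS.markovShift A) θ (k + 1) φ C := by
    obtain ⟨C, hC⟩ := hφlip
    exact ⟨max C 0, le_max_right _ _, fun n hn ω hω υ hυ hag => (hC n hn ω hω υ hυ hag).trans
        (mul_le_mul_of_nonneg_right (le_max_left _ _) (pow_pos hθ0 n).le)⟩
  have hθ' : 0 < 1 - θ := by linarith
  obtain ⟨K, hK, hCK⟩ : ∃ K, 2 ≤ K ∧ θ * (C + K) ≤ K := by
    have h1 : 0 ≤ C / (1 - θ) := div_nonneg hC0 hθ'.le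
    have h2 : C / (1 - θ) * (1 - θ) = C := div_mul_cancel₀ _ hθ'.ne'
    exact ⟨2 + C / (1 - θ), by linarith, by nlinarith⟩
  constructor
  · intro hpos
    by_contra hno
    have hac : ∀ a, ¬ Relation.TransGen M a a := fun a h => hno (TMSProof.periodic_of_cycle h)
    set R := TMS.specRad (TMS.normK (TMS.markovShift A) θ k)
        (TMS.Fkb (TMS.markovShift A) θ k) (TMS.transfer M φ) with hR
    have hε : 0 < R / 8 := by linarith
    obtain ⟨h, H, hH0, h1, hH, hT⟩ := TMSProof.lyapunov hp hp0 hac hε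
    have hρ : 0 ≤ 2 * (R / 8) := by linarith
    have hD : 0 < (1 + K) * (H + 1) := mul_pos (by linarith) (by linarith)
    have hop : ∀ n : ℕ, TMS.opNorm (TMS.normK (TMS.markovShift A) θ k)
        (TMS.Fkb (TMS.markovShift A) θ k) ((TMS.transfer M φ)^[n]) ≤
        ((1 + K) * (H + 1)) * (2 * (R / 8)) ^ n := by
      intro n
      apply Real.sSup_le
      · rintro _ ⟨f, hf, hf1, rfl⟩
        exact TMSProof.norm_bound hMA hp hp0 hφp h1 (fun b => (hH b).trans (by linarith))
          (by linarith) hT hρ hθ0 hk hC hK hCK hf hf1 n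
      · exact mul_nonneg hD.le (pow_nonneg hρ n)
    have hev : ∀ᶠ n : ℕ in atTop, (TMS.opNorm (TMS.normK (TMS.markovShift A) θ k)
        (TMS.Fkb (TMS.markovShift A) θ k) ((TMS.transfer M φ)^[n])) ^ ((1 : ℝ) / n) ≤ R / 2 := by
      have ht := (tendsto_order.1 (TMSProof.root_tendsto _ hD)).2 2 (by norm_num)
      filter_upwards [ht, eventually_gt_atTop 0] with n hn hn0
      have hn' : (n : ℝ) ≠ 0 := by positivity
      calc _ ≤ (((1 + K) * (H + 1)) * (2 * (R / 8)) ^ n) ^ ((1 : ℝ) / n) :=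
            Real.rpow_le_rpow (TMSProof.opNorm_nonneg _ _ _ _ _) (hop n) (by positivity)
        _ = ((1 + K) * (H + 1)) ^ ((1 : ℝ) / n) * (2 * (R / 8)) := by
            rw [Real.mul_rpow hD.le (pow_nonneg hρ n), one_div,
              Real.pow_rpow_inv_natCast hρ hn0.ne']
        _ ≤ 2 * (2 * (R / 8)) := mul_le_mul_of_nonneg_right hn.le hρ
        _ = R / 2 := by ring
    have hle : R ≤ R / 2 := by
      refine Filter.limsup_le_of_le ?_ hev
      exact Filter.isCoboundedUnder_le_of_le atTop (x := 0) fun n =>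
        Real.rpow_nonneg (TMSProof.opNorm_nonneg _ _ _ _ _) _
    linarith
  · rintro ⟨ω, hω, m, hm, hper⟩
    set P := ∑' a, p a with hP
    have hP0 : 0 ≤ P := tsum_nonneg hp0
    have hT : ∀ b, ∑' a : {a : S // M a b}, p a * (fun _ : S => (1:ℝ)) a ≤
        P * (fun _ : S => (1:ℝ)) b := by
      intro b
      simp only [mul_one]
      exact hp.tsum_subtype_le p {a | M a b} hp0
    have h1 : ∀ b : S, 1 ≤ (fun _ : S => (1:ℝ)) b := fun _ => le_rfl
    have hH : ∀ b : S, (fun _ : S => (1:ℝ)) b ≤ 1 := fun _ => le_rfl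
    have hN : ∀ n : ℕ, ∀ r ∈ {r | ∃ f ∈ TMS.Fkb (TMS.markovShift A) θ k,
        TMS.normK (TMS.markovShift A) θ k f ≤ 1 ∧
        r = TMS.normK (TMS.markovShift A) θ k ((TMS.transfer M φ)^[n] f)},
        r ≤ (1 + K) * P ^ n := by
      rintro n _ ⟨f, hf, hf1, rfl⟩
      have := TMSProof.norm_bound hMA hp hp0 hφp h1 hH zero_le_one hT hP0 hθ0 hk hC hK hCK hf hf1 n
      simpa using this
    have hK1 : 0 < 1 + K := by linarith
    have hone : (fun _ => (1:ℝ)) ∈ TMS.Fkb (TMS.markovShift A) θ k := by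
      refine ⟨⟨continuousOn_const, 1, ?_⟩, 0, ?_⟩
      · rintro _ ⟨υ, _, rfl⟩; simp
      · intro n _ υ _ υ' _ _; simp
    have hone1 : TMS.normK (TMS.markovShift A) θ k (fun _ => (1:ℝ)) ≤ 1 := by
      have e1 : TMS.supNorm (TMS.markovShift A) (fun _ => (1:ℝ)) ≤ 1 := by
        apply Real.sSup_le _ zero_le_one
        rintro _ ⟨υ, _, rfl⟩; simp
      have e2 : TMS.lipSemi (TMS.markovShift A) θ k (fun _ => (1:ℝ)) ≤ 0 := by
        apply csInf_le ⟨0, fun _ h => h.1⟩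
        refine ⟨le_rfl, ?_⟩
        intro n _ υ _ υ' _ _; simp
      unfold TMS.normK; linarith
    have hsb : ∀ n, ∀ υ ∈ TMS.markovShift A,
        |(TMS.transfer M φ)^[n] (fun _ => 1) υ| ≤ P ^ n * 1 :=
      fun n => TMSProof.sup_bound hMA hp hp0 hφp h1 hH hT hP0 (f := fun _ => 1)
        (fun _ _ => by simp) n
    -- lower bound of the potential along the orbit
    obtain ⟨β, hβ⟩ : ∃ β, ∀ n, β ≤ φ (TMS.shift^[n] ω) := by
      have hne : (Finset.range m).Nonempty := ⟨0, by simpa using hm⟩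
      refine ⟨(Finset.range m).inf' hne (fun i => φ (TMS.shift^[i] ω)), fun n => ?_⟩
      have hpp : Function.IsPeriodicPt TMS.shift m ω := hper
      rw [← hpp.iterate_mod_apply n]
      exact Finset.inf'_le (fun i => φ (TMS.shift^[i] ω)) (by simpa using Nat.mod_lt n hm)
    have hlow := TMSProof.lower hMA hp hp0 hφp (fun n => ⟨_, hsb n⟩) hω hβ
    have hmem : ∀ n, TMS.shift^[n] ω ∈ TMS.markovShift A := by
      intro n i
      rw [TMSProof.shift_iter, TMSProof.shift_iter, Nat.add_right_comm]
      exact hMA _ _ (hω _)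
    have hopl : ∀ n : ℕ, Real.exp β ^ n ≤ TMS.opNorm (TMS.normK (TMS.markovShift A) θ k)
        (TMS.Fkb (TMS.markovShift A) θ k) ((TMS.transfer M φ)^[n]) := by
      intro n
      have e1 : TMS.normK (TMS.markovShift A) θ k ((TMS.transfer M φ)^[n] (fun _ => 1)) ≤ _ :=
        le_csSup ⟨_, hN n⟩ ⟨_, hone, hone1, rfl⟩
      refine le_trans ?_ e1
      have e2 : |(TMS.transfer M φ)^[n] (fun _ => 1) (TMS.shift^[n] ω)| ≤
          TMS.supNorm (TMS.markovShift A) ((TMS.transfer M φ)^[n] (fun _ => 1)) := by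
        refine le_csSup ⟨P ^ n * 1, ?_⟩ ⟨_, hmem n, rfl⟩
        rintro _ ⟨υ, hυ, rfl⟩
        exact hsb n υ hυ
      have e3 := TMSProof.lipSemi_nonneg (TMS.markovShift A) θ k
        ((TMS.transfer M φ)^[n] (fun _ => 1))
      have e4 := (hlow n).trans (le_abs_self _)
      unfold TMS.normK; linarith
    have hopu : ∀ n : ℕ, TMS.opNorm (TMS.normK (TMS.markovShift A) θ k)
        (TMS.Fkb (TMS.markovShift A) θ k) ((TMS.transfer M φ)^[n]) ≤ (1 + K) * P ^ n :=
      fun n => Real.sSup_le (hN n) (mul_nonneg hK1.le (pow_nonneg hP0 n))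
    refine lt_of_lt_of_le (Real.exp_pos β) ?_
    refine Filter.le_limsup_of_frequently_le (Eventually.frequently ?_) ?_
    · filter_upwards [eventually_gt_atTop 0] with n hn0
      calc Real.exp β = (Real.exp β ^ n) ^ ((1 : ℝ) / n) := by
            rw [one_div, Real.pow_rpow_inv_natCast (Real.exp_pos _).le hn0.ne']
        _ ≤ _ := Real.rpow_le_rpow (by positivity) (hopl n) (by positivity)
    · refine ⟨2 * P, ?_⟩
      rw [eventually_map]
      have ht := (tendsto_order.1 (TMSProof.root_tendsto _ hK1)).2 2 (by norm_num)
      filter_upwards [ht, eventually_gt_atTop 0] with n hn hn0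
      calc _ ≤ ((1 + K) * P ^ n) ^ ((1 : ℝ) / n) :=
            Real.rpow_le_rpow (TMSProof.opNorm_nonneg _ _ _ _ _) (hopu n) (by positivity)
        _ = (1 + K) ^ ((1 : ℝ) / n) * P := by
            rw [Real.mul_rpow hK1.le (pow_nonneg hP0 n), one_div,
              Real.pow_rpow_inv_natCast hP0 hn0.ne']
        _ ≤ 2 * P := mul_le_mul_of_nonneg_right hn.le hP0
end

section
/- Under (A.1)-(A.3), the spectral radius of L_M on F^k_b(X) equals the maximum over transitive components: r(L_M) = max_{T ∈ S/↔} r(L_{M(T)}), where M(T) is the irreducible submatrix of M indexed by the communication class T. -/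
open Filter MeasureTheory Topology
open scoped ENNReal NNReal BigOperators

namespace TMS

section Helpers

variable {S : Type*}

/-- Summary of the summability hypothesis. -/
structure Ctx (A : S → S → Prop) (φ : (ℕ → S) → ℝ) (W : S → ℝ) : Prop where
  nonneg : ∀ a, 0 ≤ W a
  summ : Summable W
  le : ∀ a ω, ω ∈ markovShift A → A a (ω 0) → Real.exp (φ (cons a ω)) ≤ W a

open Classical in
/-- one summand of the transfer operator -/
noncomputable def term (M : S → S → Prop) (φ f : (ℕ → S) → ℝ) (ω : ℕ → S) (a : S) : ℝ :=
  if M a (ω 0) then Real.exp (φ (cons a ω)) * f (cons a ω) else 0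

theorem transfer_eq (M : S → S → Prop) (φ f : (ℕ → S) → ℝ) (ω : ℕ → S) :
    transfer M φ f ω = ∑' a, term M φ f ω a := by
  unfold transfer
  have := tsum_subtype {a | M a (ω 0)} (fun a => Real.exp (φ (cons a ω)) * f (cons a ω))
  refine this.trans ?_
  congr 1

theorem cons_mem {A : S → S → Prop} {a : S} {ω : ℕ → S} (hω : ω ∈ markovShift A)
    (h : A a (ω 0)) : cons a ω ∈ markovShift A := by
  intro n
  cases n with
  | zero => exact h
  | succ n => exact hω n

/-- the iterates of the transfer operator applied to the constant function one -/
noncomputable def G (M : S → S → Prop) (φ : (ℕ → S) → ℝ) (n : ℕ) : (ℕ → S) → ℝ :=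
  (transfer M φ)^[n] (fun _ => 1)

theorem G_succ (M : S → S → Prop) (φ : (ℕ → S) → ℝ) (n : ℕ) :
    G M φ (n + 1) = transfer M φ (G M φ n) := by
  unfold G
  rw [Function.iterate_succ_apply']

section Main

variable {A M : S → S → Prop} {φ : (ℕ → S) → ℝ} {W : S → ℝ}

theorem term_abs_le (hc : Ctx A φ W) (hM : ∀ a b, M a b → A a b) {f : (ℕ → S) → ℝ} {B : ℝ}
    (hB : 0 ≤ B)
    (hf : ∀ ω ∈ markovShift A, |f ω| ≤ B) {ω : ℕ → S} (hω : ω ∈ markovShift A) (a : S) :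
    |term M φ f ω a| ≤ W a * B := by
  unfold term
  split_ifs with h
  · rw [abs_mul, abs_of_pos (Real.exp_pos _)]
    exact mul_le_mul (hc.le a ω hω (hM _ _ h)) (hf _ (cons_mem hω (hM _ _ h))) (abs_nonneg _)
      (hc.nonneg a)
  · simp only [abs_zero]
    exact mul_nonneg (hc.nonneg a) hB

theorem summ_term (hc : Ctx A φ W) (hM : ∀ a b, M a b → A a b) {f : (ℕ → S) → ℝ} {B : ℝ}
    (hf : ∀ ω ∈ markovShift A, |f ω| ≤ B) {ω : ℕ → S} (hω : ω ∈ markovShift A) :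
    Summable (term M φ f ω) := by
  have hB : 0 ≤ B := (abs_nonneg _).trans (hf ω hω)
  refine Summable.of_norm_bounded (hc.summ.mul_right B) ?_
  intro a
  exact term_abs_le hc hM hB hf hω a

theorem transfer_bd (hc : Ctx A φ W) (hM : ∀ a b, M a b → A a b) {f : (ℕ → S) → ℝ} {B : ℝ}
    (hf : ∀ ω ∈ markovShift A, |f ω| ≤ B) {ω : ℕ → S} (hω : ω ∈ markovShift A) :
    |transfer M φ f ω| ≤ (∑' a, W a) * B := by
  have hB : 0 ≤ B := (abs_nonneg _).trans (hf ω hω)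
  rw [transfer_eq, ← tsum_mul_right]
  have := tsum_of_norm_bounded (f := term M φ f ω) (hc.summ.mul_right B).hasSum
    (fun a => term_abs_le hc hM hB hf hω a)
  exact this

theorem iter_bd (hc : Ctx A φ W) (hM : ∀ a b, M a b → A a b) {f : (ℕ → S) → ℝ} {B : ℝ}
    (hf : ∀ ω ∈ markovShift A, |f ω| ≤ B) (n : ℕ) : ∀ {ω : ℕ → S}, ω ∈ markovShift A →
    |(transfer M φ)^[n] f ω| ≤ (∑' a, W a) ^ n * B := by
  induction n with
  | zero => intro ω hω; simpa using hf ω hω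
  | succ n ih =>
    intro ω hω
    rw [Function.iterate_succ_apply', pow_succ', mul_assoc]
    exact transfer_bd hc hM (fun ω hω => ih hω) hω

theorem G_bd (hc : Ctx A φ W) (hM : ∀ a b, M a b → A a b) (n : ℕ) (ω : ℕ → S)
    (hω : ω ∈ markovShift A) : |G M φ n ω| ≤ (∑' a, W a) ^ n := by
  have := iter_bd hc hM (f := fun _ => 1) (B := 1) (by simp) n hω
  simpa [G] using this

theorem transfer_mono (hc : Ctx A φ W) (hM : ∀ a b, M a b → A a b) {f g : (ℕ → S) → ℝ} {B B' : ℝ}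
    (hf : ∀ ω ∈ markovShift A, |f ω| ≤ B) (hg : ∀ ω ∈ markovShift A, |g ω| ≤ B')
    (hfg : ∀ ω ∈ markovShift A, f ω ≤ g ω) {ω : ℕ → S} (hω : ω ∈ markovShift A) :
    transfer M φ f ω ≤ transfer M φ g ω := by
  rw [transfer_eq, transfer_eq]
  refine (summ_term hc hM hf hω).tsum_le_tsum ?_ (summ_term hc hM hg hω)
  intro a
  unfold term
  split_ifs with h
  · exact mul_le_mul_of_nonneg_left (hfg _ (cons_mem hω (hM _ _ h))) (Real.exp_pos _).le
  · exact le_rfl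

theorem G_nonneg (M : S → S → Prop) (hM : ∀ a b, M a b → A a b)
    (n : ℕ) : ∀ ω ∈ markovShift A, 0 ≤ G M φ n ω := by
  induction n with
  | zero => intro ω hω; simp [G]
  | succ n ih =>
    intro ω hω
    rw [G_succ, transfer_eq]
    refine tsum_nonneg fun a => ?_
    unfold term
    split_ifs with h
    · exact mul_nonneg (Real.exp_pos _).le (ih _ (cons_mem hω (hM _ _ h)))
    · exact le_rfl

theorem transfer_smul (M : S → S → Prop) (c : ℝ) (f : (ℕ → S) → ℝ) (ω : ℕ → S) :
    transfer M φ (fun ω => c * f ω) ω = c * transfer M φ f ω := by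
  unfold transfer
  rw [← tsum_mul_left]
  congr 1
  ext a
  ring

/-- iterates on bounded functions are dominated by iterates on constants -/
theorem iter_le_G (hc : Ctx A φ W) (hM : ∀ a b, M a b → A a b) {f : (ℕ → S) → ℝ} {B : ℝ}
    (hf : ∀ ω ∈ markovShift A, |f ω| ≤ B) (n : ℕ) : ∀ {ω : ℕ → S}, ω ∈ markovShift A →
    |(transfer M φ)^[n] f ω| ≤ B * G M φ n ω := by
  induction n with
  | zero => intro ω hω; simpa [G] using hf ω hω
  | succ n ih =>
    intro ω hω
    have hB : 0 ≤ B := (abs_nonneg _).trans (hf ω hω)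
    have hb2 : ∀ ω ∈ markovShift A, |B * G M φ n ω| ≤ B * (∑' a, W a) ^ n := by
      intro ω hω
      rw [abs_mul, abs_of_nonneg hB]
      exact mul_le_mul_of_nonneg_left (G_bd hc hM n ω hω) hB
    rw [Function.iterate_succ_apply', G_succ, ← transfer_smul, abs_le]
    constructor
    · have h1 := transfer_mono hc hM (f := fun ω => (-1) * (B * G M φ n ω)) (g := (transfer M φ)^[n] f)
        (B := B * (∑' a, W a) ^ n)
        (by intro ω hω; rw [abs_mul]; simpa using hb2 ω hω)
        (fun ω hω => iter_bd hc hM hf n hω)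
        (by intro ω hω; have := (abs_le.1 (ih hω)).1; linarith) hω
      rw [transfer_smul] at h1
      linarith
    · exact transfer_mono hc hM (fun ω hω => iter_bd hc hM hf n hω) hb2
        (fun ω hω => (abs_le.1 (ih hω)).2) hω

/-- Supersolutions control the growth. -/
theorem supersol (hc : Ctx A φ W) (hM : ∀ a b, M a b → A a b) {h : (ℕ → S) → ℝ} {C R : ℝ}
    (hR : 0 ≤ R)
    (h1 : ∀ ω ∈ markovShift A, 1 ≤ h ω) (hC : ∀ ω ∈ markovShift A, h ω ≤ C)
    (hL : ∀ ω ∈ markovShift A, transfer M φ h ω ≤ R * h ω) (n : ℕ) :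
    ∀ ω ∈ markovShift A, G M φ n ω ≤ R ^ n * h ω := by
  induction n with
  | zero => intro ω hω; simpa [G] using h1 ω hω
  | succ n ih =>
    intro ω hω
    have hb : ∀ ω ∈ markovShift A, |R ^ n * h ω| ≤ R ^ n * C := by
      intro ω hω
      have := h1 ω hω
      rw [abs_of_nonneg (by positivity)]
      exact mul_le_mul_of_nonneg_left (hC ω hω) (by positivity)
    rw [G_succ]
    refine (transfer_mono hc hM (G_bd hc hM n) hb ih hω).trans ?_
    rw [transfer_smul, pow_succ, mul_assoc]
    exact mul_le_mul_of_nonneg_left (hL ω hω) (by positivity)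

/-! ### Distortion -/

theorem exp_sub_le {x y c : ℝ} (h : |x - y| ≤ c) :
    |Real.exp x - Real.exp y| ≤ Real.exp x * (c * Real.exp c) := by
  have hc : 0 ≤ c := (abs_nonneg _).trans h
  obtain ⟨h1, h2⟩ := abs_le.1 h
  have e1 : Real.exp y = Real.exp x * Real.exp (y - x) := by
    rw [← Real.exp_add]; ring_nf
  have e2 : Real.exp x - Real.exp y = Real.exp x * (1 - Real.exp (y - x)) := by
    rw [e1]; ring
  rw [e2, abs_mul, abs_of_pos (Real.exp_pos _)]
  refine mul_le_mul_of_nonneg_left ?_ (Real.exp_pos _).le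
  have h3 : 1 ≤ Real.exp c := Real.one_le_exp hc
  rw [abs_le]
  constructor
  · have h4 : Real.exp (y - x) ≤ Real.exp c := Real.exp_le_exp.2 (by linarith)
    have h5 := Real.add_one_le_exp (-c)
    have h6 : Real.exp c * Real.exp (-c) = 1 := by rw [← Real.exp_add]; simp
    nlinarith [Real.exp_pos c]
  · have h5 := Real.add_one_le_exp (y - x)
    nlinarith

theorem cons_agree {ω υ : ℕ → S} {m : ℕ} (h : ∀ i, i < m → ω i = υ i) (a : S) :
    ∀ i, i < m + 1 → cons a ω i = cons a υ i := by
  intro i hi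
  cases i with
  | zero => rfl
  | succ i => exact h i (by omega)

theorem G_dist (hc : Ctx A φ W) (hM : ∀ a b, M a b → A a b) {θ : ℝ} (hθ0 : 0 < θ) (hθ1 : θ < 1)
    {k : ℕ} (hk : 1 ≤ k) {C : ℝ}
    (hφ : LipBound (markovShift A) θ (k + 1) φ C) (n : ℕ) :
    ∀ m, k ≤ m → ∀ ω ∈ markovShift A, ∀ υ ∈ markovShift A, (∀ i, i < m → ω i = υ i) →
      G M φ n ω ≤ Real.exp ((C * θ / (1 - θ)) * θ ^ m) * G M φ n υ := by
  induction n with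
  | zero =>
    intro m hm ω hω υ hυ hag
    have hC : 0 ≤ C := by
      have := hφ (k + 1) le_rfl ω hω ω hω (fun _ _ => rfl)
      simp only [sub_self, abs_zero] at this
      exact nonneg_of_mul_nonneg_left this (by positivity)
    have : 0 ≤ C * θ / (1 - θ) * θ ^ m := by
      have : 0 < 1 - θ := by linarith
      positivity
    simpa [G] using this
  | succ n ih =>
    intro m hm ω hω υ hυ hag
    have h0 : ω 0 = υ 0 := hag 0 (by omega)
    rw [G_succ, transfer_eq, transfer_eq, ← tsum_mul_left]
    refine (summ_term hc hM (G_bd hc hM n) hω).tsum_le_tsum ?_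
      ((summ_term hc hM (G_bd hc hM n) hυ).mul_left _)
    intro a
    unfold term
    rw [← h0]
    split_ifs with h
    · have ha1 := cons_mem hω (hM _ _ h)
      have ha2 := cons_mem hυ (hM _ _ (h0 ▸ h))
      have e1 := hφ (m + 1) (by omega) _ ha1 _ ha2 (cons_agree hag a)
      have e2 := ih (m + 1) (by omega) _ ha1 _ ha2 (cons_agree hag a)
      have e3 : Real.exp (φ (cons a ω)) ≤ Real.exp (C * θ ^ (m + 1)) * Real.exp (φ (cons a υ)) := by
        rw [← Real.exp_add]
        exact Real.exp_le_exp.2 (by linarith [(abs_le.1 e1).2])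
      have hg := G_nonneg (φ := φ) M hM n _ ha2
      calc _ ≤ (Real.exp (C * θ ^ (m + 1)) * Real.exp (φ (cons a υ))) *
            (Real.exp ((C * θ / (1 - θ)) * θ ^ (m + 1)) * G M φ n (cons a υ)) := by
            exact mul_le_mul e3 e2 (G_nonneg M hM n _ ha1) (by positivity)
        _ = (Real.exp (C * θ ^ (m + 1)) * Real.exp ((C * θ / (1 - θ)) * θ ^ (m + 1))) *
            (Real.exp (φ (cons a υ)) * G M φ n (cons a υ)) := by ring
        _ = _ := by
            rw [← Real.exp_add]
            congr 2
            have : 1 - θ ≠ 0 := by linarith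
            field_simp
            ring
    · simp

theorem iter_dist (hc : Ctx A φ W) (hM : ∀ a b, M a b → A a b) {θ : ℝ} (hθ0 : 0 < θ) (hθ1 : θ < 1)
    {k : ℕ} (hk : 1 ≤ k) {C : ℝ} (hC : 0 ≤ C)
    (hφ : LipBound (markovShift A) θ (k + 1) φ C) {f : (ℕ → S) → ℝ} {D K : ℝ}
    (hf1 : ∀ ω ∈ markovShift A, |f ω| ≤ 1) (hf : LipBound (markovShift A) θ k f D)
    (hDK : D ≤ K)
    (hK : C * Real.exp C * Real.exp (C * θ / (1 - θ)) * θ + θ * K ≤ K) (n : ℕ) :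
    ∀ m, k ≤ m → ∀ ω ∈ markovShift A, ∀ υ ∈ markovShift A, (∀ i, i < m → ω i = υ i) →
      |(transfer M φ)^[n] f ω - (transfer M φ)^[n] f υ| ≤ K * θ ^ m * G M φ n υ := by
  induction n with
  | zero =>
    intro m hm ω hω υ hυ hag
    have := hf m hm ω hω υ hυ hag
    have h2 : D * θ ^ m ≤ K * θ ^ m := by gcongr
    simpa [G] using this.trans h2
  | succ n ih =>
    intro m hm ω hω υ hυ hag
    have h0 : ω 0 = υ 0 := hag 0 (by omega)
    set g := (transfer M φ)^[n] f with hg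
    have hgb : ∀ ω ∈ markovShift A, |g ω| ≤ (∑' a, W a) ^ n * 1 := fun ω hω => iter_bd hc hM hf1 n hω
    set E := C * Real.exp C with hE
    have hE0 : 0 ≤ E := by positivity
    have s1 := summ_term hc hM hgb hω
    have s2 := summ_term hc hM hgb hυ
    have s3 := summ_term hc hM (G_bd hc hM n) hω
    have s4 := summ_term hc hM (G_bd hc hM n) hυ
    have key : ∀ a, |term M φ g ω a - term M φ g υ a| ≤
        E * θ ^ (m + 1) * term M φ (G M φ n) ω a + K * θ ^ (m + 1) * term M φ (G M φ n) υ a := by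
      intro a
      unfold term
      rw [← h0]
      split_ifs with h
      · have ha1 := cons_mem hω (hM _ _ h)
        have ha2 := cons_mem hυ (hM _ _ (h0 ▸ h))
        have e1 := hφ (m + 1) (by omega) _ ha1 _ ha2 (cons_agree hag a)
        have e2 := ih (m + 1) (by omega) _ ha1 _ ha2 (cons_agree hag a)
        have e3 := exp_sub_le e1
        have e4 : C * θ ^ (m + 1) * Real.exp (C * θ ^ (m + 1)) ≤ E * θ ^ (m + 1) := by
          have : C * θ ^ (m + 1) ≤ C := mul_le_of_le_one_right hC (pow_le_one₀ hθ0.le hθ1.le)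
          have h2 : Real.exp (C * θ ^ (m + 1)) ≤ Real.exp C := Real.exp_le_exp.2 this
          have h3 : 0 ≤ C * θ ^ (m + 1) := by positivity
          calc _ ≤ C * θ ^ (m + 1) * Real.exp C := mul_le_mul_of_nonneg_left h2 h3
            _ = _ := by rw [hE]; ring
        have e5 : |g (cons a ω)| ≤ G M φ n (cons a ω) := by
          have := iter_le_G hc hM hf1 n ha1
          simpa using this
        have e6 : Real.exp (φ (cons a ω)) * g (cons a ω) - Real.exp (φ (cons a υ)) * g (cons a υ)
          = (Real.exp (φ (cons a ω)) - Real.exp (φ (cons a υ))) * g (cons a ω)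
            + Real.exp (φ (cons a υ)) * (g (cons a ω) - g (cons a υ)) := by ring
        rw [e6]
        refine (abs_add_le _ _).trans ?_
        rw [abs_mul, abs_mul, abs_of_pos (Real.exp_pos (φ (cons a υ)))]
        have p1 := (Real.exp_pos (φ (cons a ω))).le
        have p2 := (Real.exp_pos (φ (cons a υ))).le
        refine add_le_add ?_ ?_
        · calc _ ≤ (Real.exp (φ (cons a ω)) * (E * θ ^ (m + 1))) * G M φ n (cons a ω) := by
                refine mul_le_mul (e3.trans (mul_le_mul_of_nonneg_left e4 p1)) e5 (abs_nonneg _)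
                  (by positivity)
            _ = _ := by ring
        · calc _ ≤ Real.exp (φ (cons a υ)) * (K * θ ^ (m + 1) * G M φ n (cons a υ)) :=
                mul_le_mul_of_nonneg_left e2 p2
            _ = _ := by ring
      · simp
    rw [Function.iterate_succ_apply', ← hg, transfer_eq, transfer_eq, ← s1.tsum_sub s2]
    have hs := ((s3.mul_left (E * θ ^ (m + 1))).add (s4.mul_left (K * θ ^ (m + 1))))
    have h1 := tsum_of_norm_bounded
      (f := fun a => term M φ g ω a - term M φ g υ a) hs.hasSum key
    rw [Real.norm_eq_abs, (s3.mul_left (E * θ ^ (m + 1))).tsum_add (s4.mul_left (K * θ ^ (m + 1))),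
      tsum_mul_left, tsum_mul_left, ← transfer_eq, ← transfer_eq, ← G_succ] at h1
    refine h1.trans ?_
    have h2 := G_dist hc hM hθ0 hθ1 hk hφ (n + 1) m hm ω hω υ hυ hag
    have hgn := G_nonneg (φ := φ) M hM (n + 1) υ hυ
    have h1θ : 0 < 1 - θ := by linarith
    have h3 : Real.exp ((C * θ / (1 - θ)) * θ ^ m) ≤ Real.exp (C * θ / (1 - θ)) := by
      apply Real.exp_le_exp.2
      exact mul_le_of_le_one_right (by positivity) (pow_le_one₀ hθ0.le hθ1.le)
    have h4 : G M φ (n + 1) ω ≤ Real.exp (C * θ / (1 - θ)) * G M φ (n + 1) υ :=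
      h2.trans (mul_le_mul_of_nonneg_right h3 hgn)
    calc _ ≤ E * θ ^ (m + 1) * (Real.exp (C * θ / (1 - θ)) * G M φ (n + 1) υ)
          + K * θ ^ (m + 1) * G M φ (n + 1) υ := by gcongr
      _ = (E * Real.exp (C * θ / (1 - θ)) * θ + θ * K) * (θ ^ m * G M φ (n + 1) υ) := by ring
      _ ≤ K * (θ ^ m * G M φ (n + 1) υ) := mul_le_mul_of_nonneg_right hK (by positivity)
      _ = _ := by ring



/-! ### Norms and spectral radius -/

theorem supNorm_le {X : Set (ℕ → S)} (hX : X.Nonempty) {f : (ℕ → S) → ℝ} {c : ℝ}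
    (h : ∀ ω ∈ X, |f ω| ≤ c) : supNorm X f ≤ c := by
  refine csSup_le (hX.image _) ?_
  rintro _ ⟨ω, hω, rfl⟩
  exact h ω hω

theorem le_supNorm {X : Set (ℕ → S)} {f : (ℕ → S) → ℝ} {c : ℝ}
    (h : ∀ ω ∈ X, |f ω| ≤ c) {ω : ℕ → S} (hω : ω ∈ X) : |f ω| ≤ supNorm X f := by
  refine le_csSup ⟨c, ?_⟩ ⟨ω, hω, rfl⟩
  rintro _ ⟨ω, hω, rfl⟩
  exact h ω hω

theorem lipSemi_nonneg (X : Set (ℕ → S)) (θ : ℝ) (k : ℕ) (f : (ℕ → S) → ℝ) :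
    0 ≤ lipSemi X θ k f := Real.sInf_nonneg fun _ h => h.1

theorem lipSemi_le {X : Set (ℕ → S)} {θ : ℝ} {k : ℕ} {f : (ℕ → S) → ℝ} {C : ℝ} (hC : 0 ≤ C)
    (h : LipBound X θ k f C) : lipSemi X θ k f ≤ C :=
  csInf_le ⟨0, fun _ h => h.1⟩ ⟨hC, h⟩

variable [TopologicalSpace S]

/-- all standing hypotheses -/
structure Std (A : S → S → Prop) (φ : (ℕ → S) → ℝ) (W : S → ℝ) (θ : ℝ) (k : ℕ) (C : ℝ) : Prop where
  ctx : Ctx A φ W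
  h0 : 0 < θ
  h1 : θ < 1
  hk : 1 ≤ k
  hC : 0 ≤ C
  lip : LipBound (markovShift A) θ (k + 1) φ C
  ne : (markovShift A).Nonempty

/-- distortion constant -/
noncomputable def Kc (θ C : ℝ) : ℝ :=
  2 + C * Real.exp C * Real.exp (C * θ / (1 - θ)) * θ / (1 - θ)

variable {θ : ℝ} {k : ℕ} {C : ℝ}

theorem Kc_ge (hs : Std A φ W θ k C) : 2 ≤ Kc θ C := by
  have h1θ : 0 < 1 - θ := by linarith [hs.h1]
  have := hs.h0
  have := hs.hC
  unfold Kc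
  have : 0 ≤ C * Real.exp C * Real.exp (C * θ / (1 - θ)) * θ / (1 - θ) := by positivity
  linarith

theorem Kc_prop (hs : Std A φ W θ k C) :
    C * Real.exp C * Real.exp (C * θ / (1 - θ)) * θ + θ * Kc θ C ≤ Kc θ C := by
  have h1θ : 0 < 1 - θ := by linarith [hs.h1]
  unfold Kc
  set E := C * Real.exp C * Real.exp (C * θ / (1 - θ)) * θ
  have : E / (1 - θ) * (1 - θ) = E := div_mul_cancel₀ _ h1θ.ne'
  nlinarith

theorem norm_iter_le (hs : Std A φ W θ k C) (hM : ∀ a b, M a b → A a b) {n : ℕ} {c : ℝ}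
    (hc : ∀ ω ∈ markovShift A, G M φ n ω ≤ c) {f : (ℕ → S) → ℝ}
    (hf : f ∈ Fkb (markovShift A) θ k) (hf1 : normK (markovShift A) θ k f ≤ 1) :
    normK (markovShift A) θ k ((transfer M φ)^[n] f) ≤ (1 + Kc θ C) * c := by
  have hKc := Kc_ge hs
  obtain ⟨ω0, hω0⟩ := hs.ne
  have hc0 : 0 ≤ c := (G_nonneg M hM n ω0 hω0).trans (hc ω0 hω0)
  obtain ⟨⟨-, B, hB⟩, D0, hD0⟩ := hf
  have hB' : ∀ ω ∈ markovShift A, |f ω| ≤ B := fun ω hω => hB ⟨ω, hω, rfl⟩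
  have hl0 := lipSemi_nonneg (markovShift A) θ k f
  have hsup0 : 0 ≤ supNorm (markovShift A) f := (abs_nonneg _).trans (le_supNorm hB' hω0)
  have hb1 : ∀ ω ∈ markovShift A, |f ω| ≤ 1 := by
    intro ω hω
    have := le_supNorm hB' hω
    unfold normK at hf1
    linarith
  have hlt : sInf {C | 0 ≤ C ∧ LipBound (markovShift A) θ k f C} < 2 := by
    unfold normK lipSemi at hf1
    linarith
  have hne : {C | 0 ≤ C ∧ LipBound (markovShift A) θ k f C}.Nonempty := by
    refine ⟨|D0|, abs_nonneg _, ?_⟩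
    intro n hn ω hω υ hυ h
    refine (hD0 n hn ω hω υ hυ h).trans ?_
    have := hs.h0
    exact mul_le_mul_of_nonneg_right (le_abs_self _) (by positivity)
  obtain ⟨D, ⟨-, hD⟩, hD2⟩ := exists_lt_of_csInf_lt hne hlt
  have hd := iter_dist hs.ctx hM hs.h0 hs.h1 hs.hk hs.hC hs.lip hb1 hD (hD2.le.trans hKc)
    (Kc_prop hs) n
  have e1 : supNorm (markovShift A) ((transfer M φ)^[n] f) ≤ c := by
    refine supNorm_le hs.ne fun ω hω => ?_
    have := iter_le_G hs.ctx hM hb1 n hω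
    rw [one_mul] at this
    exact this.trans (hc ω hω)
  have e2 : lipSemi (markovShift A) θ k ((transfer M φ)^[n] f) ≤ Kc θ C * c := by
    refine lipSemi_le (by positivity) ?_
    intro m hm ω hω υ hυ h
    refine (hd m hm ω hω υ hυ h).trans ?_
    have := hs.h0
    calc _ ≤ Kc θ C * θ ^ m * c := mul_le_mul_of_nonneg_left (hc υ hυ) (by positivity)
      _ = _ := by ring
  unfold normK
  linarith

theorem one_mem (hs : Std A φ W θ k C) : (fun _ => 1) ∈ Fkb (markovShift A) θ k := by
  refine ⟨⟨continuousOn_const, 1, ?_⟩, 0, ?_⟩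
  · rintro _ ⟨ω, hω, rfl⟩
    simp
  · intro n hn ω hω υ hυ h
    simp

theorem one_norm (hs : Std A φ W θ k C) : normK (markovShift A) θ k (fun _ => 1) ≤ 1 := by
  have e1 : supNorm (markovShift A) (fun _ => (1 : ℝ)) ≤ 1 := supNorm_le hs.ne (by simp)
  have e2 : lipSemi (markovShift A) θ k (fun _ => (1 : ℝ)) ≤ 0 := by
    refine lipSemi_le le_rfl ?_
    intro n hn ω hω υ hυ h
    simp
  unfold normK
  linarith

theorem opNorm_le (hs : Std A φ W θ k C) (hM : ∀ a b, M a b → A a b) {n : ℕ} {c : ℝ}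
    (hc : ∀ ω ∈ markovShift A, G M φ n ω ≤ c) :
    opNorm (normK (markovShift A) θ k) (Fkb (markovShift A) θ k) ((transfer M φ)^[n])
      ≤ (1 + Kc θ C) * c := by
  refine csSup_le ⟨_, _, one_mem hs, one_norm hs, rfl⟩ ?_
  rintro _ ⟨f, hf, hf1, rfl⟩
  exact norm_iter_le hs hM hc hf hf1

theorem le_opNorm (hs : Std A φ W θ k C) (hM : ∀ a b, M a b → A a b) (n : ℕ) :
    ∀ ω ∈ markovShift A, G M φ n ω ≤
    opNorm (normK (markovShift A) θ k) (Fkb (markovShift A) θ k) ((transfer M φ)^[n]) := by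
  intro ω hω
  have h1 : normK (markovShift A) θ k (G M φ n) ≤
      opNorm (normK (markovShift A) θ k) (Fkb (markovShift A) θ k) ((transfer M φ)^[n]) := by
    refine le_csSup ⟨(1 + Kc θ C) * (∑' a, W a) ^ n, ?_⟩ ⟨_, one_mem hs, one_norm hs, rfl⟩
    rintro _ ⟨f, hf, hf1, rfl⟩
    exact norm_iter_le hs hM (fun ω hω => (le_abs_self _).trans (G_bd hs.ctx hM n ω hω)) hf hf1
  have h2 := le_supNorm (G_bd hs.ctx hM n) hω
  have h3 := lipSemi_nonneg (markovShift A) θ k (G M φ n)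
  have h4 := le_abs_self (G M φ n ω)
  unfold normK at h1
  unfold normK
  linarith

theorem opNorm_nonneg (hs : Std A φ W θ k C) (hM : ∀ a b, M a b → A a b) (n : ℕ) :
    0 ≤ opNorm (normK (markovShift A) θ k) (Fkb (markovShift A) θ k) ((transfer M φ)^[n]) := by
  obtain ⟨ω, hω⟩ := hs.ne
  exact (G_nonneg M hM n ω hω).trans (le_opNorm hs hM n ω hω)

/-- shorthand for the spectral radius -/
noncomputable def rad (A M : S → S → Prop) (φ : (ℕ → S) → ℝ) (θ : ℝ) (k : ℕ) : ℝ :=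
  specRad (normK (markovShift A) θ k) (Fkb (markovShift A) θ k) (transfer M φ)

theorem root_tendsto {Q R : ℝ} (hQ : 0 < Q) :
    Tendsto (fun n : ℕ => Q ^ ((1 : ℝ) / n) * R) atTop (𝓝 R) := by
  have h1 : Tendsto (fun n : ℕ => (1 : ℝ) / n) atTop (𝓝 0) := tendsto_one_div_atTop_nhds_zero_nat
  have h2 := ((Real.continuous_const_rpow hQ.ne').tendsto 0).comp h1
  simpa using h2.mul_const R

theorem root_le {x Q R : ℝ} {n : ℕ} (hn : 1 ≤ n) (hx : 0 ≤ x) (hQ : 0 < Q) (hR : 0 ≤ R)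
    (h : x ≤ Q * R ^ n) : x ^ ((1 : ℝ) / n) ≤ Q ^ ((1 : ℝ) / n) * R := by
  have : (0 : ℝ) ≤ 1 / n := by positivity
  refine (Real.rpow_le_rpow hx h this).trans ?_
  rw [Real.mul_rpow hQ.le (by positivity), one_div, Real.pow_rpow_inv_natCast hR (by omega)]

theorem bdd_roots (hs : Std A φ W θ k C) (hM : ∀ a b, M a b → A a b) :
    IsBoundedUnder (· ≤ ·) atTop (fun n : ℕ => (opNorm (normK (markovShift A) θ k)
      (Fkb (markovShift A) θ k) ((transfer M φ)^[n])) ^ ((1 : ℝ) / n)) := by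
  have hK := Kc_ge hs
  have hQ : 0 < 1 + Kc θ C := by linarith
  have hW : 0 ≤ ∑' a, W a := tsum_nonneg hs.ctx.nonneg
  refine (root_tendsto (R := ∑' a, W a) hQ).isBoundedUnder_le.mono_le ?_
  filter_upwards [eventually_ge_atTop 1] with n hn
  exact root_le hn (opNorm_nonneg hs hM n) hQ hW
    (opNorm_le hs hM (fun ω hω => (le_abs_self _).trans (G_bd hs.ctx hM n ω hω)))

theorem rad_le (hs : Std A φ W θ k C) (hM : ∀ a b, M a b → A a b) {R c : ℝ} (hR : 0 ≤ R)
    (hc : 0 < c)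
    (h : ∀ᶠ n in atTop, ∀ ω ∈ markovShift A, G M φ n ω ≤ c * R ^ n) :
    rad A M φ θ k ≤ R := by
  have hK := Kc_ge hs
  have hQ : 0 < (1 + Kc θ C) * c := by positivity
  have ht := root_tendsto (R := R) hQ
  rw [← ht.limsup_eq]
  refine limsup_le_limsup ?_ ?_ ht.isBoundedUnder_le
  · filter_upwards [eventually_ge_atTop 1, h] with n hn h
    refine root_le hn (opNorm_nonneg hs hM n) hQ hR ?_
    rw [mul_assoc]
    exact opNorm_le hs hM h
  · refine IsBoundedUnder.isCoboundedUnder_le ⟨0, ?_⟩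
    simp only [eventually_map]
    exact Eventually.of_forall fun n => Real.rpow_nonneg (opNorm_nonneg hs hM n) _

theorem of_rad_lt (hs : Std A φ W θ k C) (hM : ∀ a b, M a b → A a b) {R : ℝ}
    (h : rad A M φ θ k < R) :
    ∀ᶠ n in atTop, ∀ ω ∈ markovShift A, G M φ n ω ≤ R ^ n := by
  have := eventually_lt_of_limsup_lt h (bdd_roots hs hM)
  filter_upwards [this, eventually_ge_atTop 1] with n h1 hn ω hω
  refine (le_opNorm hs hM n ω hω).trans ?_
  have h0 := opNorm_nonneg hs hM n
  have h2 := pow_le_pow_left₀ (Real.rpow_nonneg h0 _) h1.le n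
  rwa [one_div, Real.rpow_inv_natCast_pow h0 (by omega)] at h2

theorem rad_nonneg (hs : Std A φ W θ k C) (hM : ∀ a b, M a b → A a b) : 0 ≤ rad A M φ θ k := by
  refine le_limsup_of_frequently_le ?_ (bdd_roots hs hM)
  exact (Eventually.of_forall fun n => Real.rpow_nonneg (opNorm_nonneg hs hM n) _).frequently

theorem G_mono_mat (hc : Ctx A φ W) (hM : ∀ a b, M a b → A a b) {N : S → S → Prop}
    (hN : ∀ a b, N a b → M a b) (n : ℕ) :
    ∀ ω ∈ markovShift A, G N φ n ω ≤ G M φ n ω := by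
  have hN' : ∀ a b, N a b → A a b := fun a b h => hM _ _ (hN _ _ h)
  induction n with
  | zero => intro ω hω; simp [G]
  | succ n ih =>
    intro ω hω
    rw [G_succ, G_succ, transfer_eq, transfer_eq]
    refine (summ_term hc hN' (G_bd hc hN' n) hω).tsum_le_tsum ?_ (summ_term hc hM (G_bd hc hM n) hω)
    intro a
    unfold term
    split_ifs with h h' h'
    · exact mul_le_mul_of_nonneg_left (ih _ (cons_mem hω (hM _ _ h'))) (Real.exp_pos _).le
    · exact absurd (hN _ _ h) h'
    · exact mul_nonneg (Real.exp_pos _).le (G_nonneg M hM n _ (cons_mem hω (hM _ _ h')))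
    · exact le_rfl

theorem rad_mono (hs : Std A φ W θ k C) (hM : ∀ a b, M a b → A a b) {N : S → S → Prop}
    (hN : ∀ a b, N a b → M a b) : rad A N φ θ k ≤ rad A M φ θ k := by
  have hN' : ∀ a b, N a b → A a b := fun a b h => hM _ _ (hN _ _ h)
  refine le_of_forall_gt_imp_ge_of_dense fun R hR => ?_
  refine rad_le hs hN' ((rad_nonneg hs hM).trans hR.le) one_pos ?_
  filter_upwards [of_rad_lt hs hM hR] with n hn ω hω
  rw [one_mul]
  exact (G_mono_mat hs.ctx hM hN n ω hω).trans (hn ω hω)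

/-! ### Communication classes -/

theorem reaches_iff {S : Type*} (M : S → S → Prop) (a b : S) :
    reaches M a b ↔ Relation.TransGen M a b := by
  constructor
  · rintro ⟨l, hl⟩
    induction l generalizing a with
    | nil =>
      have : M a b := by simpa [List.Chain] using hl
      exact Relation.TransGen.single this
    | cons c l ih =>
      have h2 : M a c ∧ List.IsChain M (c :: (l ++ [b])) := by
        simpa [List.Chain] using hl
      exact Relation.TransGen.head h2.1 (ih c h2.2)
  · intro h
    induction h using Relation.TransGen.head_induction_on with
    | single h => exact ⟨[], by simpa [List.Chain] using h⟩
    | @head x y h _ ih =>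
      obtain ⟨l, hl⟩ := ih
      refine ⟨y :: l, ?_⟩
      have hl' : List.IsChain M (y :: (l ++ [b])) := hl
      have := List.IsChain.cons_cons h hl'
      exact this

theorem comm_iff {S : Type*} (M : S → S → Prop) (a b : S) :
    comm M a b ↔ Relation.ReflTransGen M a b ∧ Relation.ReflTransGen M b a := by
  unfold comm
  rw [reaches_iff, reaches_iff]
  constructor
  · rintro (rfl | ⟨h1, h2⟩)
    · exact ⟨.refl, .refl⟩
    · exact ⟨h1.to_reflTransGen, h2.to_reflTransGen⟩
  · rintro ⟨h1, h2⟩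
    by_cases h : a = b
    · exact Or.inl h
    · right
      rw [Relation.reflTransGen_iff_eq_or_transGen] at h1 h2
      exact ⟨h1.resolve_left (fun e => h e.symm), h2.resolve_left h⟩

theorem comm_symm {a b : S} (h : comm M a b) : comm M b a := by
  rw [comm_iff] at *; exact ⟨h.2, h.1⟩

theorem comm_trans {a b c : S} (h : comm M a b) (h' : comm M b c) : comm M a c := by
  rw [comm_iff] at *; exact ⟨h.1.trans h'.1, h'.2.trans h.2⟩

/-- `a` communicates with an element of `F` -/
def Big (M : S → S → Prop) (F : Finset S) (a : S) : Prop := ∃ s ∈ F, comm M s a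

/-- the diagonal part of `M` -/
def DM (M : S → S → Prop) (F : Finset S) (a b : S) : Prop := M a b ∧ comm M a b ∧ Big M F a

open Classical in
/-- the level of a symbol -/
noncomputable def lev (M : S → S → Prop) (F : Finset S) (a : S) : ℕ :=
  (F.filter fun s => Relation.ReflTransGen M s a ∧ ¬ Relation.ReflTransGen M a s).card

theorem lev_le (F : Finset S) (a : S) : lev M F a ≤ F.card := by
  classical
  exact Finset.card_filter_le _ _

theorem lev_mono (F : Finset S) {a b : S} (h : M a b) : lev M F a ≤ lev M F b := by
  classical
  refine Finset.card_le_card ?_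
  intro s
  simp only [Finset.mem_filter]
  rintro ⟨h1, h2, h3⟩
  exact ⟨h1, h2.tail h, fun h4 => h3 (Relation.ReflTransGen.head h h4)⟩

theorem lev_lt {F : Finset S} {a b : S} (h : M a b) (hb : Big M F a) (hn : ¬ comm M a b) :
    lev M F a < lev M F b := by
  classical
  obtain ⟨s, hs, hsa⟩ := hb
  rw [comm_iff] at hsa
  refine Finset.card_lt_card (Finset.ssubset_iff_subset_ne.2 ⟨?_, ?_⟩)
  · intro s
    simp only [Finset.mem_filter]
    rintro ⟨h1, h2, h3⟩
    exact ⟨h1, h2.tail h, fun h4 => h3 (Relation.ReflTransGen.head h h4)⟩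
  · intro he
    have h1 : s ∈ F.filter fun s => Relation.ReflTransGen M s b ∧ ¬ Relation.ReflTransGen M b s := by
      simp only [Finset.mem_filter]
      refine ⟨hs, hsa.1.tail h, fun h4 => hn ?_⟩
      rw [comm_iff]
      exact ⟨.single h, h4.trans hsa.1⟩
    rw [← he] at h1
    simp only [Finset.mem_filter] at h1
    exact h1.2.2 hsa.2

theorem transfer_zero {f : (ℕ → S) → ℝ} {ω : ℕ → S} (h : ∀ a, ¬ M a (ω 0)) :
    transfer M φ f ω = 0 := by
  rw [transfer_eq]
  have : ∀ a, term M φ f ω a = 0 := fun a => by unfold term; rw [if_neg (h a)]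
  simp [this]

theorem DM_not_big {F : Finset S} {b : S} (hb : ¬ Big M F b) (a : S) : ¬ DM M F a b := by
  rintro ⟨-, h2, s, hs, h3⟩
  exact hb ⟨s, hs, comm_trans h3 h2⟩

theorem G_D_small {F : Finset S} {ω : ℕ → S} (hb : ¬ Big M F (ω 0)) (n : ℕ) :
    G (DM M F) φ (n + 1) ω = 0 := by
  rw [G_succ]
  exact transfer_zero (DM_not_big hb)

theorem G_D_big {F : Finset S} {s : S} (hs : s ∈ F) (n : ℕ) :
    ∀ ω : ℕ → S, comm M s (ω 0) →
      G (DM M F) φ n ω = G (restrictM M {b | comm M s b}) φ n ω := by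
  induction n with
  | zero => intro ω _; simp [G]
  | succ n ih =>
    intro ω hω
    rw [G_succ, G_succ, transfer_eq, transfer_eq]
    refine tsum_congr fun a => ?_
    have hiff : DM M F a (ω 0) ↔ restrictM M {b | comm M s b} a (ω 0) := by
      unfold DM restrictM
      simp only [Set.mem_setOf_eq]
      constructor
      · rintro ⟨h1, h2, h3⟩
        exact ⟨h1, comm_trans hω (comm_symm h2), hω⟩
      · rintro ⟨h1, h2, h3⟩
        exact ⟨h1, comm_trans (comm_symm h2) h3, s, hs, h2⟩
    unfold term
    by_cases h : DM M F a (ω 0)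
    · rw [if_pos h, if_pos (hiff.1 h), ih (cons a ω) (hiff.1 h).2.1]
    · rw [if_neg h, if_neg (fun h' => h (hiff.2 h'))]

theorem exists_tail (hc : Ctx A φ W) {ε : ℝ} (hε : 0 < ε) :
    ∃ F : Finset S, ∑' a, Set.indicator {x | x ∉ F} W a ≤ ε := by
  have h := tendsto_tsum_compl_atTop_zero W
  have h2 := (h.eventually (gt_mem_nhds hε)).exists
  obtain ⟨F, hF⟩ := h2
  refine ⟨F, ?_⟩
  rw [← tsum_subtype]
  exact hF.le

theorem rad_le_of_classes (hs : Std A φ W θ k C) (hM : ∀ a b, M a b → A a b) (S0 : Set S)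
    (hMS0 : ∀ a b, M a b → a ∈ S0 ∧ b ∈ S0) {R0 : ℝ} (hR0 : 0 ≤ R0)
    (hcl : ∀ a ∈ S0, rad A (restrictM M {b | comm M a b}) φ θ k ≤ R0) :
    rad A M φ θ k ≤ R0 := by
  classical
  refine le_of_forall_pos_le_add fun η hη => ?_
  obtain ⟨F0, hF0⟩ := exists_tail hs.ctx (show 0 < η / 3 by linarith)
  set F := F0.filter (· ∈ S0) with hF
  set R := R0 + η / 3 with hR
  have hRpos : 0 < R := by linarith
  have hrestr : ∀ s a b, restrictM M {b | comm M s b} a b → A a b := fun s a b h => hM _ _ h.1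
  -- a common exponent
  have hev : ∀ᶠ n in atTop, ∀ s ∈ F, ∀ ω ∈ markovShift A,
      G (restrictM M {b | comm M s b}) φ n ω ≤ R ^ n := by
    rw [Filter.eventually_all_finset]
    intro s hsF
    exact of_rad_lt hs (hrestr s)
      ((hcl s (Finset.mem_filter.1 hsF).2).trans_lt (by linarith))
  obtain ⟨n, hn, hn1⟩ := (hev.and (eventually_ge_atTop 1)).exists
  set D := DM M F with hD
  have hDA : ∀ a b, D a b → A a b := fun a b h => hM _ _ h.1
  have hGn : ∀ ω ∈ markovShift A, G D φ n ω ≤ R ^ n := by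
    intro ω hω
    by_cases hb : Big M F (ω 0)
    · obtain ⟨s, hsF, hsω⟩ := hb
      rw [hD, G_D_big hsF n ω hsω]
      exact hn s hsF ω hω
    · obtain ⟨m, rfl⟩ : ∃ m, n = m + 1 := ⟨n - 1, by omega⟩
      rw [hD, G_D_small hb]
      positivity
  -- the supersolution for the diagonal part
  set K := ∑' a, W a with hK
  have hK0 : 0 ≤ K := tsum_nonneg hs.ctx.nonneg
  set h : (ℕ → S) → ℝ := fun ω => ∑ j ∈ Finset.range n, (R ^ j)⁻¹ * G D φ j ω with hh
  set Cb := ∑ j ∈ Finset.range n, (R ^ j)⁻¹ * K ^ j with hCb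
  have hCb0 : 0 ≤ Cb := Finset.sum_nonneg fun j _ => by positivity
  have h_ge : ∀ ω ∈ markovShift A, 1 ≤ h ω := by
    intro ω hω
    have := Finset.single_le_sum (f := fun j => (R ^ j)⁻¹ * G D φ j ω)
      (fun j _ => mul_nonneg (by positivity) (G_nonneg D hDA j ω hω))
      (Finset.mem_range.2 (show 0 < n by omega))
    have e0 : (R ^ 0)⁻¹ * G D φ 0 ω = 1 := by simp [G]
    simp only [e0] at this
    exact this
  have h_le : ∀ ω ∈ markovShift A, h ω ≤ Cb := by
    intro ω hω
    refine Finset.sum_le_sum fun j _ => ?_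
    exact mul_le_mul_of_nonneg_left ((le_abs_self _).trans (G_bd hs.ctx hDA j ω hω)) (by positivity)
  have h_abs : ∀ ω ∈ markovShift A, |h ω| ≤ Cb := by
    intro ω hω
    rw [abs_of_nonneg (zero_le_one.trans (h_ge ω hω))]
    exact h_le ω hω
  have h_small : ∀ ω, ¬ Big M F (ω 0) → h ω = 1 := by
    intro ω hb
    rw [hh]
    simp only
    rw [Finset.sum_eq_single 0]
    · simp [G]
    · intro j _ hj
      obtain ⟨m, rfl⟩ : ∃ m, j = m + 1 := ⟨j - 1, by omega⟩
      rw [hD, G_D_small hb, mul_zero]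
    · intro hc
      exact absurd (Finset.mem_range.2 (show 0 < n by omega)) hc
  have h_D : ∀ ω ∈ markovShift A, transfer D φ h ω ≤ R * h ω := by
    intro ω hω
    have e1 : transfer D φ h ω = ∑ j ∈ Finset.range n, (R ^ j)⁻¹ * G D φ (j + 1) ω := by
      have e2 : ∀ a, term D φ h ω a =
          ∑ j ∈ Finset.range n, (R ^ j)⁻¹ * term D φ (G D φ j) ω a := by
        intro a
        unfold term
        split_ifs with hda
        · rw [hh, Finset.mul_sum]
          refine Finset.sum_congr rfl fun j _ => ?_
          ring
        · simp
      rw [transfer_eq]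
      simp only [e2]
      rw [Summable.tsum_finsetSum]
      · refine Finset.sum_congr rfl fun j _ => ?_
        rw [tsum_mul_left, ← transfer_eq, G_succ]
      · intro j _
        exact (summ_term hs.ctx hDA (G_bd hs.ctx hDA j) hω).mul_left _
    have e3 : R * h ω - transfer D φ h ω =
        ∑ j ∈ Finset.range n, (R * ((R ^ j)⁻¹ * G D φ j ω)
          - R * ((R ^ (j + 1))⁻¹ * G D φ (j + 1) ω)) := by
      rw [Finset.sum_sub_distrib, e1, hh]
      simp only
      rw [Finset.mul_sum]
      congr 1
      refine Finset.sum_congr rfl fun j _ => ?_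
      rw [pow_succ]
      field_simp
    rw [Finset.sum_range_sub'] at e3
    have e4 : (R ^ n)⁻¹ * G D φ n ω ≤ 1 := by
      rw [inv_mul_le_iff₀ (by positivity), mul_one]
      exact hGn ω hω
    have e5 : (R ^ 0)⁻¹ * G D φ 0 ω = 1 := by simp [G]
    rw [e5] at e3
    nlinarith
  -- the global supersolution
  set ρ := 1 + 3 * Cb * K / η with hρ
  have hρ1 : 1 ≤ ρ := by
    have : 0 ≤ 3 * Cb * K / η := by positivity
    linarith
  have hρ0 : 0 < ρ := by linarith
  have hρK : Cb * K / ρ ≤ η / 3 := by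
    rw [div_le_iff₀ hρ0, hρ]
    have : η / 3 * (1 + 3 * Cb * K / η) = η / 3 + Cb * K := by field_simp
    linarith
  set H : (ℕ → S) → ℝ := fun ω => ρ ^ lev M F (ω 0) * h ω with hH
  have H_ge : ∀ ω ∈ markovShift A, 1 ≤ H ω := fun ω hω =>
    one_le_mul_of_one_le_of_one_le (one_le_pow₀ hρ1) (h_ge ω hω)
  have H_le : ∀ ω ∈ markovShift A, H ω ≤ ρ ^ F.card * Cb := by
    intro ω hω
    refine mul_le_mul (pow_le_pow_right₀ hρ1 (lev_le F _)) (h_le ω hω)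
      (zero_le_one.trans (h_ge ω hω)) (by positivity)
  have H_abs : ∀ ω ∈ markovShift A, |H ω| ≤ ρ ^ F.card * Cb := by
    intro ω hω
    rw [abs_of_nonneg (zero_le_one.trans (H_ge ω hω))]
    exact H_le ω hω
  have hindS : Summable (Set.indicator {x | x ∉ F0} W) := hs.ctx.summ.indicator _
  have H_L : ∀ ω ∈ markovShift A, transfer M φ H ω ≤ (R0 + η) * H ω := by
    intro ω hω
    set P := ρ ^ lev M F (ω 0) with hP
    have hP0 : 0 < P := by positivity
    have s1 := summ_term hs.ctx hDA h_abs hω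
    have s2 := hs.ctx.summ.mul_right (Cb / ρ)
    have key : ∀ a, term M φ H ω a ≤
        P * (term D φ h ω a + (Set.indicator {x | x ∉ F0} W a + W a * (Cb / ρ))) := by
      intro a
      have hWa := hs.ctx.nonneg a
      have hi0 : 0 ≤ Set.indicator {x | x ∉ F0} W a := Set.indicator_nonneg (fun _ _ => hs.ctx.nonneg _) _
      have hx0 : 0 ≤ W a * (Cb / ρ) := by positivity
      by_cases hMa : M a (ω 0)
      · have hmem := cons_mem hω (hM _ _ hMa)
        have hw := hs.ctx.le a ω hω (hM _ _ hMa)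
        have hpl : ρ ^ lev M F a ≤ P := pow_le_pow_right₀ hρ1 (lev_mono F hMa)
        have hH' : H (cons a ω) = ρ ^ lev M F a * h (cons a ω) := rfl
        have hge := h_ge _ hmem
        have hle := h_le _ hmem
        have hex := Real.exp_pos (φ (cons a ω))
        unfold term
        rw [if_pos hMa, hH']
        by_cases hDa : D a (ω 0)
        · rw [if_pos hDa]
          have : Real.exp (φ (cons a ω)) * (ρ ^ lev M F a * h (cons a ω)) ≤
              P * (Real.exp (φ (cons a ω)) * h (cons a ω)) := by
            calc _ = ρ ^ lev M F a * (Real.exp (φ (cons a ω)) * h (cons a ω)) := by ring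
              _ ≤ _ := mul_le_mul_of_nonneg_right hpl (by positivity)
          refine this.trans (mul_le_mul_of_nonneg_left ?_ hP0.le)
          linarith
        · rw [if_neg hDa, zero_add]
          by_cases hb : Big M F a
          · have hnc : ¬ comm M a (ω 0) := fun hcm => hDa ⟨hMa, hcm, hb⟩
            have hlt := lev_lt hMa hb hnc
            have hp2 : ρ ^ lev M F a ≤ P / ρ := by
              rw [le_div_iff₀ hρ0, ← pow_succ]
              exact pow_le_pow_right₀ hρ1 hlt
            have : Real.exp (φ (cons a ω)) * (ρ ^ lev M F a * h (cons a ω)) ≤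
                P * (W a * (Cb / ρ)) := by
              calc _ ≤ W a * (P / ρ * Cb) :=
                    mul_le_mul hw (mul_le_mul hp2 hle (by linarith) (by positivity))
                      (by positivity) hWa
                _ = _ := by ring
            refine this.trans (mul_le_mul_of_nonneg_left ?_ hP0.le)
            linarith
          · have hh1 : h (cons a ω) = 1 := h_small _ hb
            have haF : a ∉ F0 := fun haF =>
              hb ⟨a, Finset.mem_filter.2 ⟨haF, (hMS0 _ _ hMa).1⟩, Or.inl rfl⟩
            have hi : Set.indicator {x | x ∉ F0} W a = W a := Set.indicator_of_mem (by exact haF) _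
            rw [hh1, hi, mul_one]
            have : Real.exp (φ (cons a ω)) * ρ ^ lev M F a ≤ P * W a := by
              rw [mul_comm P]
              exact mul_le_mul hw hpl (by positivity) hWa
            refine this.trans (mul_le_mul_of_nonneg_left ?_ hP0.le)
            linarith
      · have hDa : ¬ D a (ω 0) := fun hh => hMa hh.1
        unfold term
        rw [if_neg hMa, if_neg hDa, zero_add]
        positivity
    rw [transfer_eq]
    have s3 := hindS.add s2
    refine ((summ_term hs.ctx hM H_abs hω).tsum_le_tsum key ((s1.add s3).mul_left P)).trans ?_
    rw [tsum_mul_left, s1.tsum_add s3, hindS.tsum_add s2, tsum_mul_right, ← transfer_eq, ← hK]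
    have e1 := h_D ω hω
    have e2 := h_ge ω hω
    have e3 : K * (Cb / ρ) ≤ η / 3 := by
      rw [mul_div_assoc'] ; rwa [mul_comm K Cb]
    have e4 : (R0 + η) * H ω = P * ((R0 + η) * h ω) := by rw [hH]; ring
    rw [e4]
    refine mul_le_mul_of_nonneg_left ?_ hP0.le
    rw [hR] at e1
    nlinarith
  have hc : 0 < ρ ^ F.card * Cb := by
    obtain ⟨ω, hω⟩ := hs.ne
    linarith [H_ge ω hω, H_le ω hω]
  refine rad_le hs hM (by linarith) hc (Eventually.of_forall fun m ω hω => ?_)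
  refine (supersol hs.ctx hM (by linarith) H_ge H_le H_L m ω hω).trans ?_
  rw [mul_comm]
  exact mul_le_mul_of_nonneg_right (H_le ω hω) (by positivity)

theorem rad_small (hs : Std A φ W θ k C) (hM : ∀ a b, M a b → A a b) {F : Finset S} {ε : ℝ}
    (hε : 0 ≤ ε) (hF : ∑' a, Set.indicator {x | x ∉ F} W a ≤ ε)
    (hMF : ∀ a b, M a b → a ∉ F) : rad A M φ θ k ≤ ε := by
  refine rad_le hs hM hε one_pos (Eventually.of_forall fun n ω hω => ?_)
  refine (supersol (h := fun _ => 1) (C := 1) hs.ctx hM hε (by simp) (by simp) ?_ n ω hω).trans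
    (by simp)
  intro ω hω
  rw [transfer_eq, mul_one]
  refine le_trans ?_ hF
  refine (summ_term hs.ctx hM (B := 1) (by simp) hω).tsum_le_tsum ?_ (hs.ctx.summ.indicator _)
  intro a
  unfold term
  split_ifs with h
  · rw [Set.indicator_of_mem (by exact hMF _ _ h), mul_one]
    exact hs.ctx.le a ω hω (hM _ _ h)
  · exact Set.indicator_nonneg (fun _ _ => hs.ctx.nonneg _) _

theorem exists_attained (hs : Std A φ W θ k C) (hM : ∀ a b, M a b → A a b) (S0 : Set S)
    (hMS0 : ∀ a b, M a b → a ∈ S0 ∧ b ∈ S0) (hne : S0.Nonempty) :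
    ∃ a ∈ S0, rad A M φ θ k = rad A (restrictM M {b | comm M a b}) φ θ k := by
  classical
  have hle : ∀ a, rad A (restrictM M {b | comm M a b}) φ θ k ≤ rad A M φ θ k :=
    fun a => rad_mono hs hM fun _ _ h => h.1
  have hrestr : ∀ s a b, restrictM M {b | comm M s b} a b → A a b := fun s a b h => hM _ _ h.1
  by_contra! hcon
  have hlt : ∀ a ∈ S0, rad A (restrictM M {b | comm M a b}) φ θ k < rad A M φ θ k :=
    fun a ha => lt_of_le_of_ne (hle a) (hcon a ha).symm
  obtain ⟨a0, ha0⟩ := hne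
  have hpos : 0 < rad A M φ θ k := (rad_nonneg hs (hrestr a0)).trans_lt (hlt a0 ha0)
  obtain ⟨F0, hF0⟩ := exists_tail hs.ctx (half_pos hpos)
  set r := rad A M φ θ k with hr
  have : ∃ R, r / 2 ≤ R ∧ R < r ∧
      ∀ s ∈ F0.filter (· ∈ S0), rad A (restrictM M {b | comm M s b}) φ θ k ≤ R := by
    have hgen : ∀ F : Finset S, (∀ s ∈ F, s ∈ S0) → ∃ R, r / 2 ≤ R ∧ R < r ∧
        ∀ s ∈ F, rad A (restrictM M {b | comm M s b}) φ θ k ≤ R := by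
      intro F
      induction F using Finset.induction_on with
      | empty => intro _; exact ⟨r / 2, le_rfl, by linarith, by simp⟩
      | insert s F _ ih =>
        intro hF
        obtain ⟨R, h1, h2, h3⟩ := ih fun t ht => hF t (Finset.mem_insert_of_mem ht)
        refine ⟨max R (rad A (restrictM M {b | comm M s b}) φ θ k), h1.trans (le_max_left _ _),
          max_lt h2 (hlt s (hF s (Finset.mem_insert_self _ _))), ?_⟩
        intro t ht
        rcases Finset.mem_insert.1 ht with rfl | ht
        · exact le_max_right _ _
        · exact (h3 t ht).trans (le_max_left _ _)
    exact hgen _ fun s h => (Finset.mem_filter.1 h).2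
  obtain ⟨R, h1, h2, h3⟩ := this
  have := rad_le_of_classes hs hM S0 hMS0 (R0 := R) (by linarith) ?_
  · linarith
  intro a ha
  by_cases hb : Big M (F0.filter (· ∈ S0)) a
  · obtain ⟨s, hsF, hsa⟩ := hb
    have : {b | comm M a b} = {b | comm M s b} := by
      ext b
      exact ⟨fun h => comm_trans hsa h, fun h => comm_trans (comm_symm hsa) h⟩
    rw [this]
    exact h3 s hsF
  · refine (rad_small hs (hrestr a) (by linarith) hF0 ?_).trans h1
    rintro x y ⟨hxy, hx, -⟩ hxF
    exact hb ⟨x, Finset.mem_filter.2 ⟨hxF, (hMS0 _ _ hxy).1⟩, comm_symm hx⟩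

end Main

end Helpers

end TMS

/-- under (A.1)-(A.3), the spectral radius of `L_M` on `F^k_b(X)`
equals the maximum over transitive components `T ∈ S/↔` of the spectral radii of
`L_{M(T)}`. -/
theorem stmt13 {S : Type*} [Countable S] [TopologicalSpace S] [DiscreteTopology S]
    (A M : S → S → Prop) (S0 : Set S) (hMS0 : ∀ a b, M a b → a ∈ S0 ∧ b ∈ S0)
    (hMA : ∀ a b, M a b → A a b) (hA : TMS.FinitelyIrreducible A)
    (θ : ℝ) (hθ0 : 0 < θ) (hθ1 : θ < 1) (k : ℕ) (hk : 1 ≤ k)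
    (φ : (ℕ → S) → ℝ) (hφ : TMS.SummableOn (TMS.markovShift A) φ)
    (hφlip : ∃ C, TMS.LipBound (TMS.markovShift A) θ (k + 1) φ C)
    (hper : TMS.HasPeriodicPoint (TMS.markovShift M)) :
    (∃ a ∈ S0,
      TMS.specRad (TMS.normK (TMS.markovShift A) θ k) (TMS.Fkb (TMS.markovShift A) θ k)
          (TMS.transfer M φ) =
        TMS.specRad (TMS.normK (TMS.markovShift A) θ k) (TMS.Fkb (TMS.markovShift A) θ k)
          (TMS.transfer (TMS.restrictM M {b | TMS.comm M a b}) φ)) ∧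
    TMS.specRad (TMS.normK (TMS.markovShift A) θ k) (TMS.Fkb (TMS.markovShift A) θ k)
        (TMS.transfer M φ) =
      sSup {r | ∃ a ∈ S0,
        r = TMS.specRad (TMS.normK (TMS.markovShift A) θ k)
          (TMS.Fkb (TMS.markovShift A) θ k)
          (TMS.transfer (TMS.restrictM M {b | TMS.comm M a b}) φ)} := by
  classical
  obtain ⟨ω0, hω0, -⟩ := hper
  have hω0A : ω0 ∈ TMS.markovShift A := fun n => hMA _ _ (hω0 n)
  obtain ⟨C, hC⟩ := hφlip
  set X := TMS.markovShift A with hX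
  obtain ⟨hbd, hsum⟩ := hφ
  let W : S → ℝ := Set.indicator {s | (TMS.cyl1 X s).Nonempty}
    (fun s => Real.exp (sSup (φ '' TMS.cyl1 X s)))
  have hs : TMS.Std A φ W θ k C := by
    refine ⟨⟨?_, ?_, ?_⟩, hθ0, hθ1, hk, ?_, hC, ⟨ω0, hω0A⟩⟩
    · intro a
      exact Set.indicator_nonneg (fun _ _ => (Real.exp_pos _).le) _
    · exact summable_subtype_iff_indicator.1 hsum
    · intro a ω hω ha
      have hmem : TMS.cons a ω ∈ TMS.cyl1 X a := ⟨TMS.cons_mem hω ha, rfl⟩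
      have : W a = Real.exp (sSup (φ '' TMS.cyl1 X a)) :=
        Set.indicator_of_mem (s := {s | (TMS.cyl1 X s).Nonempty}) ⟨_, hmem⟩ _
      rw [this]
      exact Real.exp_le_exp.2 (le_csSup (hbd a) ⟨_, hmem, rfl⟩)
    · have := hC (k + 1) le_rfl ω0 hω0A ω0 hω0A (fun _ _ => rfl)
      simp only [sub_self, abs_zero] at this
      exact nonneg_of_mul_nonneg_left this (by positivity)
  have hatt := TMS.exists_attained hs hMA S0 hMS0 ⟨ω0 0, (hMS0 _ _ (hω0 0)).1⟩
  refine ⟨hatt, ?_⟩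
  symm
  refine IsGreatest.csSup_eq ⟨?_, ?_⟩
  · exact hatt
  · rintro _ ⟨a, -, rfl⟩
    exact TMS.rad_mono hs hMA fun _ _ h => h.1
end
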